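/- arXiv:2405.03283 — 4 statements merged into one kernel-verified Lean document; each statement's English description precedes it below -/
import Mathlib

section
/- Let n ≥ 3 and fix any ε₀ > 0. Then there exist constants 0 < λ ≤ Λ and a sequence of positive functions u_k ∈ C²(B₂), where B₂ ⊂ ℝⁿ is the open Euclidean ball of radius 2 centered at the origin, such that |P⁻_{λ,Λ}(D²u_k(x))| ≤ |Du_k(x)|^{1+ε₀} pointwise for every x ∈ B₂, while m_k := inf_{B₁} u_k → 0 as k → ∞ and M_k := sup_{B₁} u_k ≥ 1 for every k ∈ ℕ. In particular, ∫_{m_k}^{M_k} ds/(s^{1+ε₀} + s) → ∞ as k → ∞. -/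
open Set Filter

/-- Pucci minimal operator `P⁻_{λ,Λ}`. -/
noncomputable def pucciMinus {n : ℕ} (lam Lam : ℝ) (M : Matrix (Fin n) (Fin n) ℝ) : ℝ :=
  letI := Classical.propDecidable M.IsHermitian
  if h : M.IsHermitian then
    lam * ∑ i, max (h.eigenvalues i) 0 + Lam * ∑ i, min (h.eigenvalues i) 0
  else 0

/-- Hessian matrix of `u : ℝⁿ → ℝ`. -/
noncomputable def hessian {n : ℕ} (u : EuclideanSpace ℝ (Fin n) → ℝ)
    (x : EuclideanSpace ℝ (Fin n)) : Matrix (Fin n) (Fin n) ℝ :=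
  Matrix.of fun i j =>
    fderiv ℝ (fun y => fderiv ℝ u y (EuclideanSpace.single i 1)) x (EuclideanSpace.single j 1)

namespace Matrix.IsHermitian

variable {n : ℕ} {M : Matrix (Fin n) (Fin n) ℝ}

lemma toEuclideanLin_eigenvectorBasis (hM : M.IsHermitian) (i : Fin n) :
    M.toEuclideanLin (hM.eigenvectorBasis i) = hM.eigenvalues i • hM.eigenvectorBasis i := by
  ext j
  have := congrFun (hM.mulVec_eigenvectorBasis i) j
  simpa [Matrix.toLpLin_apply] using this

lemma inner_toEuclideanLin_self (hM : M.IsHermitian) (v : EuclideanSpace ℝ (Fin n)) :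
    inner ℝ v (M.toEuclideanLin v) =
      ∑ i, hM.eigenvalues i * inner ℝ (hM.eigenvectorBasis i) v ^ 2 := by
  conv_lhs => rw [← hM.eigenvectorBasis.sum_repr' v]
  rw [map_sum, sum_inner]
  refine Finset.sum_congr rfl fun i _ => ?_
  rw [inner_sum]
  simp only [map_smul, hM.toEuclideanLin_eigenvectorBasis, inner_smul_left, inner_smul_right,
    hM.eigenvectorBasis.inner_eq_ite]
  simp
  ring

lemma inner_toEuclideanLin_le_sum_max (hM : M.IsHermitian) (v : EuclideanSpace ℝ (Fin n)) :
    inner ℝ v (M.toEuclideanLin v) ≤ ‖v‖ ^ 2 * ∑ i, max (hM.eigenvalues i) 0 := by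
  rw [hM.inner_toEuclideanLin_self, Finset.mul_sum]
  have hsum := hM.eigenvectorBasis.sum_sq_inner_right v
  refine Finset.sum_le_sum fun i _ => ?_
  have h1 : inner ℝ (hM.eigenvectorBasis i) v ^ 2 ≤ ‖v‖ ^ 2 :=
    (Finset.single_le_sum (f := fun i => inner ℝ (hM.eigenvectorBasis i) v ^ 2)
      (fun j _ => sq_nonneg _) (Finset.mem_univ i)).trans hsum.le
  calc _ ≤ max (hM.eigenvalues i) 0 * inner ℝ (hM.eigenvectorBasis i) v ^ 2 := by
        gcongr; exact le_max_left _ _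
    _ ≤ max (hM.eigenvalues i) 0 * ‖v‖ ^ 2 := by gcongr
    _ = _ := mul_comm _ _

/-- If the quadratic form is dominated by `α (a ⬝ v)² + β (b ⬝ v)²`, the sum of the positive
eigenvalues is at most the trace of the dominating form. -/
lemma sum_max_eigenvalues_le (hM : M.IsHermitian) {a b : EuclideanSpace ℝ (Fin n)} {α β : ℝ}
    (hα : 0 ≤ α) (hβ : 0 ≤ β)
    (h : ∀ v, inner ℝ v (M.toEuclideanLin v) ≤ α * inner ℝ v a ^ 2 + β * inner ℝ v b ^ 2) :
    ∑ i, max (hM.eigenvalues i) 0 ≤ α * ‖a‖ ^ 2 + β * ‖b‖ ^ 2 := by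
  rw [← hM.eigenvectorBasis.sum_sq_inner_right a, ← hM.eigenvectorBasis.sum_sq_inner_right b,
    Finset.mul_sum, Finset.mul_sum, ← Finset.sum_add_distrib]
  refine Finset.sum_le_sum fun i _ => max_le ?_ (by positivity)
  simpa [hM.toEuclideanLin_eigenvectorBasis, inner_smul_right,
    hM.eigenvectorBasis.inner_eq_one] using h (hM.eigenvectorBasis i)

lemma pucciMinus_eq (hM : M.IsHermitian) (lam Lam : ℝ) :
    pucciMinus lam Lam M =
      Lam * M.trace - (Lam - lam) * ∑ i, max (hM.eigenvalues i) 0 := by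
  have htr : M.trace = ∑ i, max (hM.eigenvalues i) 0 + ∑ i, min (hM.eigenvalues i) 0 := by
    rw [hM.trace_eq_sum_eigenvalues, ← Finset.sum_add_distrib]
    exact Finset.sum_congr rfl fun i _ => by simp [max_add_min]
  rw [pucciMinus, dif_pos hM, htr]
  ring

end Matrix.IsHermitian

section Spike

variable {n : ℕ} (i₀ : Fin n)

/-- The orthogonal projection along the `i₀`-th coordinate axis. -/
noncomputable def perp : EuclideanSpace ℝ (Fin n) →L[ℝ] EuclideanSpace ℝ (Fin n) :=
  ContinuousLinearMap.id ℝ _ -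
    (EuclideanSpace.proj i₀).smulRight (EuclideanSpace.single i₀ (1 : ℝ))

lemma perp_apply (x : EuclideanSpace ℝ (Fin n)) :
    perp i₀ x = x - x i₀ • EuclideanSpace.single i₀ (1 : ℝ) := by
  simp [perp]

lemma perp_apply_same (x : EuclideanSpace ℝ (Fin n)) : perp i₀ x i₀ = 0 := by
  simp [perp_apply]

lemma perp_perp (x : EuclideanSpace ℝ (Fin n)) : perp i₀ (perp i₀ x) = perp i₀ x := by
  rw [perp_apply i₀ (perp i₀ x), perp_apply_same, zero_smul, sub_zero]

lemma inner_perp_perp (x v : EuclideanSpace ℝ (Fin n)) :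
    inner ℝ (perp i₀ x) (perp i₀ v) = inner ℝ (perp i₀ x) v := by
  rw [perp_apply i₀ v, inner_sub_right, inner_smul_right, EuclideanSpace.inner_single_right]
  simp [perp_apply_same]

lemma norm_sq_eq_add_norm_perp_sq (v : EuclideanSpace ℝ (Fin n)) :
    ‖v‖ ^ 2 = v i₀ ^ 2 + ‖perp i₀ v‖ ^ 2 := by
  rw [← real_inner_self_eq_norm_sq (perp i₀ v), inner_perp_perp, real_inner_comm, perp_apply,
    inner_sub_right, inner_smul_right, EuclideanSpace.inner_single_right,
    real_inner_self_eq_norm_sq]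
  simp
  ring

/-- The weight `1 + D |y|²`, where `y` collects the coordinates of `x` other than `i₀`. -/
noncomputable def spikeWeight (D : ℝ) (x : EuclideanSpace ℝ (Fin n)) : ℝ :=
  1 + D * ‖perp i₀ x‖ ^ 2

/-- A function concentrated around the `i₀`-th coordinate axis and tilted along it. -/
noncomputable def spike (A δ D p : ℝ) (x : EuclideanSpace ℝ (Fin n)) : ℝ :=
  A * (1 + δ * x i₀) * spikeWeight i₀ D x ^ (-p)

variable {A δ D p : ℝ}

lemma one_le_spikeWeight (hD : 0 ≤ D) (x : EuclideanSpace ℝ (Fin n)) :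
    1 ≤ spikeWeight i₀ D x := by
  unfold spikeWeight
  nlinarith [mul_nonneg hD (sq_nonneg ‖perp i₀ x‖)]

lemma spikeWeight_pos (hD : 0 ≤ D) (x : EuclideanSpace ℝ (Fin n)) : 0 < spikeWeight i₀ D x :=
  one_pos.trans_le (one_le_spikeWeight i₀ hD x)

lemma contDiff_spikeWeight : ContDiff ℝ 2 (spikeWeight i₀ D) := by
  unfold spikeWeight
  exact contDiff_const.add (contDiff_const.mul ((perp i₀).contDiff.norm_sq ℝ))

lemma contDiff_spike (hD : 0 ≤ D) : ContDiff ℝ 2 (spike i₀ A δ D p) := by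
  unfold spike
  have h : ContDiff ℝ 2 fun x : EuclideanSpace ℝ (Fin n) => x i₀ :=
    (EuclideanSpace.proj (𝕜 := ℝ) i₀).contDiff
  exact (contDiff_const.mul (contDiff_const.add (contDiff_const.mul h))).mul
    ((contDiff_spikeWeight i₀).rpow_const_of_ne fun x => (spikeWeight_pos i₀ hD x).ne')

lemma hasFDerivAt_apply_same (x : EuclideanSpace ℝ (Fin n)) :
    HasFDerivAt (fun y : EuclideanSpace ℝ (Fin n) => y i₀) (EuclideanSpace.proj (𝕜 := ℝ) i₀) x :=
  (EuclideanSpace.proj (𝕜 := ℝ) i₀).hasFDerivAt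

lemma hasFDerivAt_spikeWeight (x : EuclideanSpace ℝ (Fin n)) :
    HasFDerivAt (spikeWeight i₀ D) ((2 * D) • innerSL ℝ (perp i₀ x)) x := by
  have h := (((perp i₀).hasFDerivAt (x := x)).norm_sq.const_mul D).const_add 1
  refine h.congr_fderiv ?_
  ext v
  simp [inner_perp_perp]
  ring

lemma hasFDerivAt_spikeWeight_rpow (hD : 0 ≤ D) (q : ℝ) (x : EuclideanSpace ℝ (Fin n)) :
    HasFDerivAt (fun y => spikeWeight i₀ D y ^ q)
      ((q * spikeWeight i₀ D x ^ (q - 1)) • (2 * D) • innerSL ℝ (perp i₀ x)) x :=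
  (hasFDerivAt_spikeWeight i₀ x).rpow_const (Or.inl (spikeWeight_pos i₀ hD x).ne')

lemma fderiv_spike (hD : 0 ≤ D) (x v : EuclideanSpace ℝ (Fin n)) :
    fderiv ℝ (spike i₀ A δ D p) x v =
      A * (δ * v i₀ * spikeWeight i₀ D x ^ (-p) -
        2 * p * D * (1 + δ * x i₀) * spikeWeight i₀ D x ^ (-p - 1) * inner ℝ (perp i₀ x) v) := by
  have h := ((((hasFDerivAt_apply_same i₀ x).const_mul δ).const_add 1).const_mul A).mul
    (hasFDerivAt_spikeWeight_rpow i₀ hD (-p) x)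
  have h' : HasFDerivAt (spike i₀ A δ D p) _ x := h
  rw [h'.fderiv]
  simp
  ring

lemma fderiv_fderiv_spike (hD : 0 ≤ D) (x v w : EuclideanSpace ℝ (Fin n)) :
    fderiv ℝ (fun y => fderiv ℝ (spike i₀ A δ D p) y v) x w =
      A * (-(2 * p * D * δ * spikeWeight i₀ D x ^ (-p - 1)) *
          (v i₀ * inner ℝ (perp i₀ x) w + w i₀ * inner ℝ (perp i₀ x) v) +
        4 * p * (p + 1) * D ^ 2 * (1 + δ * x i₀) * spikeWeight i₀ D x ^ (-p - 2) *
          (inner ℝ (perp i₀ x) v * inner ℝ (perp i₀ x) w) -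
        2 * p * D * (1 + δ * x i₀) * spikeWeight i₀ D x ^ (-p - 1) *
          inner ℝ (perp i₀ w) v) := by
  simp_rw [fderiv_spike i₀ hD]
  have h1 := (hasFDerivAt_spikeWeight_rpow i₀ hD (-p) x).const_mul (δ * v i₀)
  have h2 := (((hasFDerivAt_apply_same i₀ x).const_mul δ).const_add 1).const_mul (2 * p * D)
  have h3 := hasFDerivAt_spikeWeight_rpow i₀ hD (-p - 1) x
  have h4 : HasFDerivAt (fun y => inner ℝ (perp i₀ y) v)
      ((innerSL ℝ v).comp (perp i₀)) x := by
    simp_rw [real_inner_comm v]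
    exact ((innerSL ℝ v).comp (perp i₀)).hasFDerivAt
  have h : HasFDerivAt (fun y => A * (δ * v i₀ * spikeWeight i₀ D y ^ (-p) -
      2 * p * D * (1 + δ * y i₀) * spikeWeight i₀ D y ^ (-p - 1) * inner ℝ (perp i₀ y) v)) _ x :=
    (h1.sub ((h2.mul h3).mul h4)).const_mul A
  rw [h.fderiv]
  simp only [neg_mul, smul_neg, Pi.mul_apply, neg_smul, FunLike.coe_smul,
    FunLike.coe_add, FunLike.coe_sub, FunLike.coe_neg, Pi.smul_apply,
    Pi.sub_apply, Pi.add_apply, Pi.neg_apply, ContinuousLinearMap.comp_apply, innerSL_apply_apply,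
    smul_eq_mul, PiLp.proj_apply, real_inner_comm v (perp i₀ w)]
  rw [show -p - 1 - 1 = -p - 2 by ring]
  ring

open Matrix in
lemma hessian_spike (hD : 0 ≤ D) (x : EuclideanSpace ℝ (Fin n)) :
    hessian (spike i₀ A δ D p) x =
      -(2 * A * p * D * δ * spikeWeight i₀ D x ^ (-p - 1)) •
          (vecMulVec (Pi.single i₀ 1) (perp i₀ x) + vecMulVec (perp i₀ x) (Pi.single i₀ 1)) +
        (4 * A * p * (p + 1) * D ^ 2 * (1 + δ * x i₀) * spikeWeight i₀ D x ^ (-p - 2)) •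
          vecMulVec (perp i₀ x) (perp i₀ x) -
        (2 * A * p * D * (1 + δ * x i₀) * spikeWeight i₀ D x ^ (-p - 1)) •
          (1 - vecMulVec (Pi.single i₀ 1) (Pi.single i₀ 1)) := by
  ext i j
  simp only [hessian, Matrix.of_apply, fderiv_fderiv_spike i₀ hD, EuclideanSpace.inner_single_right,
    Matrix.sub_apply, Matrix.add_apply, Matrix.smul_apply, vecMulVec_apply,
    perp_apply i₀ (EuclideanSpace.single j 1)]
  simp only [PiLp.sub_apply, PiLp.smul_apply, PiLp.single_apply, Matrix.one_apply, Pi.single_apply,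
    eq_comm (a := i₀), smul_eq_mul, conj_trivial, one_mul]
  ring

open Matrix in
lemma isHermitian_hessian_spike (hD : 0 ≤ D) (x : EuclideanSpace ℝ (Fin n)) :
    (hessian (spike i₀ A δ D p) x).IsHermitian := by
  rw [hessian_spike i₀ hD]
  ext i j
  simp [vecMulVec_apply, Matrix.one_apply, eq_comm]
  ring

open Matrix in
lemma trace_hessian_spike (hD : 0 ≤ D) (x : EuclideanSpace ℝ (Fin n)) :
    (hessian (spike i₀ A δ D p) x).trace =
      4 * A * p * (p + 1) * D ^ 2 * (1 + δ * x i₀) * spikeWeight i₀ D x ^ (-p - 2) *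
          ‖perp i₀ x‖ ^ 2 -
        2 * A * p * D * (1 + δ * x i₀) * spikeWeight i₀ D x ^ (-p - 1) * (n - 1) := by
  rw [hessian_spike i₀ hD, EuclideanSpace.real_norm_sq_eq]
  simp [trace_vecMulVec, perp_apply_same]
  simp [dotProduct, sq]

open Matrix in
lemma inner_hessian_spike (hD : 0 ≤ D) (x v : EuclideanSpace ℝ (Fin n)) :
    inner ℝ v ((hessian (spike i₀ A δ D p) x).toEuclideanLin v) =
      -(4 * A * p * D * δ * spikeWeight i₀ D x ^ (-p - 1)) * (v i₀ * inner ℝ v (perp i₀ x)) +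
        4 * A * p * (p + 1) * D ^ 2 * (1 + δ * x i₀) * spikeWeight i₀ D x ^ (-p - 2) *
          inner ℝ v (perp i₀ x) ^ 2 -
        2 * A * p * D * (1 + δ * x i₀) * spikeWeight i₀ D x ^ (-p - 1) * ‖perp i₀ v‖ ^ 2 := by
  have h1 := norm_sq_eq_add_norm_perp_sq i₀ v
  rw [← real_inner_self_eq_norm_sq] at h1
  rw [hessian_spike i₀ hD, eq_sub_iff_add_eq'.2 h1.symm]
  have key (a b : EuclideanSpace ℝ (Fin n)) : inner ℝ a b = a.ofLp ⬝ᵥ b.ofLp := by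
    rw [EuclideanSpace.inner_eq_star_dotProduct, dotProduct_comm]; simp
  simp only [key, Matrix.toLpLin_apply, Matrix.add_mulVec, Matrix.sub_mulVec, Matrix.smul_mulVec,
    Matrix.vecMulVec_mulVec, dotProduct_add, dotProduct_sub, dotProduct_smul, Matrix.one_mulVec,
    single_dotProduct, dotProduct_single, dotProduct_comm (perp i₀ x).ofLp v.ofLp]
  simp
  ring

section Estimates

variable {R : ℝ}

lemma spikeWeight_rpow_sub_one (hD : 0 ≤ D) (x : EuclideanSpace ℝ (Fin n)) :
    spikeWeight i₀ D x ^ (-p - 1) = spikeWeight i₀ D x ^ (-p - 2) * spikeWeight i₀ D x := by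
  rw [← Real.rpow_add_one (spikeWeight_pos i₀ hD x).ne']
  ring_nf

lemma spikeWeight_le (hR : 1 ≤ R) {x : EuclideanSpace ℝ (Fin n)} (hx : ‖x‖ < 2) :
    spikeWeight i₀ (R ^ 2) x ≤ 5 * R ^ 2 := by
  have h1 := norm_sq_eq_add_norm_perp_sq i₀ x
  have h2 : ‖x‖ ^ 2 ≤ 4 := by nlinarith [norm_nonneg x]
  have h3 : ‖perp i₀ x‖ ^ 2 ≤ 4 := by nlinarith [sq_nonneg (x i₀)]
  unfold spikeWeight
  nlinarith [sq_nonneg R]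

lemma inner_sq_le_norm_perp (x v : EuclideanSpace ℝ (Fin n)) :
    inner ℝ v (perp i₀ x) ^ 2 ≤ ‖perp i₀ v‖ ^ 2 * ‖perp i₀ x‖ ^ 2 := by
  rw [real_inner_comm, ← inner_perp_perp, ← mul_pow, mul_comm ‖perp i₀ v‖]
  exact sq_le_sq' (by linarith [neg_le_of_abs_le (abs_real_inner_le_norm (perp i₀ x) (perp i₀ v))])
    (real_inner_le_norm _ _)

lemma abs_sub_le_of_trace_bounds {K c L p ρ T : ℝ} (hK : 0 ≤ K) (hc0 : 0 ≤ c) (hc2 : c ≤ 2)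
    (hL : 1 ≤ L) (hp : 0 ≤ p)
    (hTl : K * c * ((4 * p + 2) * (ρ - 1) - (4 * p + 4)) ≤ T)
    (hTu : T ≤ K * (2 * (2 * p + 1) * c * (ρ - 1) + 50)) :
    |K * c * (-2 * (2 * p + 1) * ρ - 2 * L + 2 * L * (2 * p + 1) * (ρ - 1)) - (L - 1) * T| ≤
      K * (100 * L * (p + 1)) := by
  have hcK : K * c ≤ K * 2 := by gcongr
  have hcK0 : 0 ≤ K * c := by positivity
  have hL1 : 0 ≤ L - 1 := by linarith
  have hu := mul_le_mul_of_nonneg_left hTu hL1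
  have hl := mul_le_mul_of_nonneg_left hTl hL1
  have e1 : (K * c) * (2 * (2 * p + 1) + 2 * L) ≤ (K * 2) * (2 * (2 * p + 1) + 2 * L) := by
    gcongr
  have e2 : (K * c) * ((L - 1) * (4 * p + 4)) ≤ (K * 2) * ((L - 1) * (4 * p + 4)) := by gcongr
  have e3 : 0 ≤ (K * c) * (2 * (2 * p + 1) + 2 * L) := by positivity
  have e4 : 0 ≤ K * ((L - 1) * p) := by positivity
  have e5 : 0 ≤ K * (L - 1) := by positivity
  have e6 : 0 ≤ K * p := by positivity
  rw [abs_le]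
  constructor <;> linarith

/-- The Pucci operator almost vanishes on the spike. -/
lemma abs_pucciMinus_hessian_spike_le {L : ℝ} (hA : 0 ≤ A) (hp : 0 ≤ p) (hR : 1 ≤ R)
    (hδ : δ * R ^ 3 = 1) (hL : 1 ≤ L) (hLp : L * (n - 2) = 2 * p + 1)
    {x : EuclideanSpace ℝ (Fin n)} (hx : ‖x‖ < 2) (hc0 : 0 ≤ 1 + δ * x i₀)
    (hc2 : 1 + δ * x i₀ ≤ 2) :
    |pucciMinus 1 L (hessian (spike i₀ A δ (R ^ 2) p) x)| ≤
      100 * L * (p + 1) * p * (A * R ^ 2 * spikeWeight i₀ (R ^ 2) x ^ (-p - 2)) := by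
  have hD : 0 ≤ R ^ 2 := sq_nonneg R
  have hδ0 : 0 ≤ δ := by
    by_contra! hlt
    nlinarith [mul_pos_of_neg_of_neg hlt (neg_lt_zero.2 (pow_pos (one_pos.trans_le hR) 3))]
  have hM := isHermitian_hessian_spike i₀ (A := A) (δ := δ) (p := p) hD x
  have htr := trace_hessian_spike i₀ (A := A) (δ := δ) (p := p) hD x
  have hq := inner_hessian_spike i₀ (A := A) (δ := δ) (p := p) hD x
  have hρ1 := one_le_spikeWeight i₀ hD x
  have hρ2 := spikeWeight_le i₀ hR hx
  have hρs : spikeWeight i₀ (R ^ 2) x = 1 + R ^ 2 * ‖perp i₀ x‖ ^ 2 := rfl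
  rw [hM.pucciMinus_eq]
  rw [spikeWeight_rpow_sub_one i₀ hD] at htr
  simp only [spikeWeight_rpow_sub_one i₀ hD] at hq
  have hw0 : 0 ≤ spikeWeight i₀ (R ^ 2) x ^ (-p - 2) :=
    Real.rpow_nonneg (zero_le_one.trans hρ1) _
  set w := spikeWeight i₀ (R ^ 2) x ^ (-p - 2)
  set ρ := spikeWeight i₀ (R ^ 2) x
  set c := 1 + δ * x i₀
  set s := ‖perp i₀ x‖ ^ 2 with hs
  have hs0 : 0 ≤ s := sq_nonneg _
  obtain ⟨h, hh⟩ : ∃ h, h = A * p * w := ⟨_, rfl⟩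
  have hh0 : 0 ≤ h := hh ▸ by positivity
  set T := ∑ i, max (hM.eigenvalues i) 0
  have hT0 : 0 ≤ T := Finset.sum_nonneg fun i _ => le_max_right _ _
  have hTu : T ≤ (h * (2 * (2 * p + 1) * c * R ^ 4 + 2 * ρ)) * ‖perp i₀ x‖ ^ 2 +
      (2 * h * R * δ * ρ) * ‖EuclideanSpace.single i₀ (1 : ℝ)‖ ^ 2 := by
    refine hM.sum_max_eigenvalues_le (by positivity) (by positivity) fun v => ?_
    rw [hq v]
    have h1 := inner_sq_le_norm_perp i₀ x v
    rw [EuclideanSpace.inner_single_right]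
    simp only [conj_trivial, one_mul]
    set τ := inner ℝ v (perp i₀ x)
    set y := ‖perp i₀ v‖ ^ 2
    have hy0 : 0 ≤ y := sq_nonneg _
    have h2 : R ^ 2 * τ ^ 2 ≤ ρ * y := by nlinarith
    have h3 : 0 ≤ 2 * h * R ^ 2 * c * (ρ * y - R ^ 2 * τ ^ 2) :=
      mul_nonneg (by positivity) (by linarith)
    have h4 : 0 ≤ 2 * h * R * δ * ρ * (v i₀ + R * τ) ^ 2 := by positivity
    have h5 : 2 * h * ρ * τ ^ 2 = 2 * h * ρ * τ ^ 2 * (δ * R ^ 3) := by rw [hδ, mul_one]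
    rw [hs] at *
    subst hh
    linarith
  have hTu' : T ≤ h * R ^ 2 * (2 * (2 * p + 1) * c * (ρ - 1) + 50) := by
    refine hTu.trans ?_
    rw [PiLp.norm_single, ← hs]
    have h1 : ρ ^ 2 ≤ 25 * R ^ 4 := by nlinarith
    have h2 : R * δ * R ^ 2 = 1 := by linarith
    have h3 : R * δ * ρ * R ^ 2 = ρ := by linear_combination ρ * h2
    have h4 : R * δ * ρ ^ 2 ≤ 25 * R ^ 2 := by
      calc R * δ * ρ ^ 2 ≤ R * δ * (25 * R ^ 4) := by gcongr
        _ = 25 * R ^ 2 := by linear_combination 25 * R ^ 2 * h2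
    have h5 : h * (R * δ * ρ ^ 2) ≤ h * (25 * R ^ 2) := by gcongr
    have h6 : ρ * s + R * δ * ρ = R * δ * ρ ^ 2 := by
      have : s = R * δ * (ρ - 1) := by rw [hρs]; linear_combination -s * h2
      rw [this]; ring
    norm_num
    have h7 : R ^ 2 * s = ρ - 1 := by rw [hρs]; ring
    have h8 : R ^ 4 * s = R ^ 2 * (ρ - 1) := by rw [← h7]; ring
    calc _ = 2 * (2 * p + 1) * c * h * (R ^ 4 * s) + 2 * h * (ρ * s + R * δ * ρ) := by ring
      _ ≤ _ := by rw [h6, h8]; linarith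
  have hTl : h * c * R ^ 2 * ((4 * p + 2) * (ρ - 1) - (4 * p + 4)) ≤ T := by
    have h1 := hM.inner_toEuclideanLin_le_sum_max (perp i₀ x)
    rw [hq, perp_apply_same, real_inner_self_eq_norm_sq, perp_perp, ← hs] at h1
    have h7 : R ^ 2 * s = ρ - 1 := by rw [hρs]; ring
    have h2 : R ^ 2 * (4 * h * (p + 1) * R ^ 4 * c * s ^ 2 - 2 * h * R ^ 2 * c * ρ * s) ≤
        ρ * T := by
      have : R ^ 2 * (4 * h * (p + 1) * R ^ 4 * c * s ^ 2 - 2 * h * R ^ 2 * c * ρ * s) ≤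
          R ^ 2 * (s * T) := by
        refine mul_le_mul_of_nonneg_left ?_ hD
        rw [hh]
        linarith
      nlinarith
    have h3 : R ^ 2 * (4 * h * (p + 1) * R ^ 4 * c * s ^ 2 - 2 * h * R ^ 2 * c * ρ * s) =
        h * c * R ^ 2 * (4 * (p + 1) * (R ^ 2 * s) ^ 2 - 2 * ρ * (R ^ 2 * s)) := by ring
    rw [h3, h7] at h2
    have h4 : 0 ≤ h * c * R ^ 2 * (4 * p + 4) := by positivity
    have hρ0 : 0 < ρ := by linarith
    refine le_of_mul_le_mul_left ?_ hρ0
    nlinarith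
  have htr' : L * (hessian (spike i₀ A δ (R ^ 2) p) x).trace =
      h * R ^ 2 * c * (-2 * (2 * p + 1) * ρ - 2 * L + 2 * L * (2 * p + 1) * (ρ - 1)) := by
    rw [htr, hh, hρs]
    linear_combination (-2 * A * p * w * c * R ^ 2 * (1 + R ^ 2 * s)) * hLp
  rw [htr', show 100 * L * (p + 1) * p * (A * R ^ 2 * w) = (h * R ^ 2) * (100 * L * (p + 1)) by
    rw [hh]; ring]
  refine abs_sub_le_of_trace_bounds (by positivity) hc0 hc2 hL hp ?_ hTu'
  rwa [mul_right_comm h c (R ^ 2)] at hTl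

lemma norm_gradient_spike_ge_axial (hD : 0 ≤ D)
    (x : EuclideanSpace ℝ (Fin n)) :
    A * δ * spikeWeight i₀ D x ^ (-p) ≤ ‖gradient (spike i₀ A δ D p) x‖ := by
  have h := (fderiv ℝ (spike i₀ A δ D p) x).le_opNorm (EuclideanSpace.single i₀ 1)
  rw [fderiv_spike i₀ hD, PiLp.norm_single, EuclideanSpace.inner_single_right,
    perp_apply_same] at h
  rw [gradient, LinearIsometryEquiv.norm_map]
  refine le_trans (le_of_eq_of_le ?_ (le_abs_self _)) (h.trans_eq ?_) <;> simp
  ring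

lemma norm_gradient_spike_ge_radial (hD : 0 ≤ D) (x : EuclideanSpace ℝ (Fin n)) :
    2 * p * A * D * (1 + δ * x i₀) * spikeWeight i₀ D x ^ (-p - 1) * ‖perp i₀ x‖ ≤
      ‖gradient (spike i₀ A δ D p) x‖ := by
  have h := (fderiv ℝ (spike i₀ A δ D p) x).le_opNorm (perp i₀ x)
  rw [fderiv_spike i₀ hD, perp_apply_same, real_inner_self_eq_norm_sq] at h
  rw [gradient, LinearIsometryEquiv.norm_map]
  rcases (norm_nonneg (perp i₀ x)).eq_or_lt with h0 | h0
  · rw [← h0]; simp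
  · refine le_of_mul_le_mul_right (le_trans ?_ h) h0
    refine le_of_eq_of_le ?_ (neg_le_abs _)
    ring

end Estimates

end Spike

lemma exists_forall_le_rpow_of_gradient_bounds {ε p q : ℝ} (C : ℝ) (hε : 0 < ε) (hC : 0 ≤ C)
    (hp : 2 ≤ p) (hq : 6 + 3 * ε ≤ q * ε) (hpq : q * ε = 2 * p * ε - 1) :
    ∃ R₀ : ℝ, 2 ≤ R₀ ∧ ∀ R, R₀ ≤ R → ∀ ρ r G : ℝ, 1 ≤ ρ → ρ ≤ 5 * R ^ 2 → 0 ≤ r →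
      ρ = 1 + R ^ 2 * r ^ 2 → R ^ q * (R ^ 3)⁻¹ * ρ ^ (-p) ≤ G →
      p * R ^ q * R ^ 2 * ρ ^ (-p - 1) * r ≤ G →
      C * (R ^ q * R ^ 2 * ρ ^ (-p - 2)) ≤ G ^ (1 + ε) := by
  obtain ⟨m, hm⟩ : ∃ m, m = (p + 1 / 2) * ε - 3 / 2 := ⟨_, rfl⟩
  have hm0 : 0 ≤ m := by rw [hm]; linarith
  refine ⟨max 2 (max (C * 2 ^ (p * (1 + ε))) (C * 5 ^ m)), le_max_left _ _, ?_⟩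
  intro R hR ρ r G hρ1 hρ5 hr hρr hG1 hG2
  have hR2 : 2 ≤ R := (le_max_left _ _).trans hR
  have hRa : C * 2 ^ (p * (1 + ε)) ≤ R := (le_max_left _ _).trans ((le_max_right _ _).trans hR)
  have hRb : C * 5 ^ m ≤ R := (le_max_right _ _).trans ((le_max_right _ _).trans hR)
  have hR0 : 0 < R := by linarith
  have hR1 : 1 ≤ R := by linarith
  have hρ0 : 0 < ρ := by linarith
  have hRq2 : R ^ q * R ^ 2 = R ^ (q + 2) := by
    rw [Real.rpow_add hR0, Real.rpow_two]
  rw [hRq2]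
  rcases le_total ρ 2 with h2 | h2
  · have hG : R ^ (q - 3) * 2 ^ (-p) ≤ G := by
      refine le_trans ?_ hG1
      have h3 : (2 : ℝ) ^ (-p) ≤ ρ ^ (-p) := Real.rpow_le_rpow_of_nonpos hρ0 h2 (by linarith)
      have h4 : R ^ (q - 3) = R ^ q * (R ^ 3)⁻¹ := by
        rw [Real.rpow_sub hR0, div_eq_mul_inv]; norm_cast
      rw [h4]
      exact mul_le_mul_of_nonneg_left h3 (by positivity)
    calc C * (R ^ (q + 2) * ρ ^ (-p - 2)) ≤ C * (R ^ (q + 2) * 1) := by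
          gcongr
          exact Real.rpow_le_one_of_one_le_of_nonpos hρ1 (by linarith)
      _ = (C * 2 ^ (p * (1 + ε))) * R ^ (q + 2) * 2 ^ (-p * (1 + ε)) := by
          rw [neg_mul, Real.rpow_neg two_pos.le]
          field_simp
      _ ≤ R * R ^ (q + 2) * 2 ^ (-p * (1 + ε)) := by gcongr
      _ = R ^ (q + 3) * 2 ^ (-p * (1 + ε)) := by
          rw [mul_comm R, ← Real.rpow_add_one hR0.ne']; ring_nf
      _ ≤ R ^ ((q - 3) * (1 + ε)) * 2 ^ (-p * (1 + ε)) := by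
          gcongr ?_ * _
          exact Real.rpow_le_rpow_of_exponent_le hR1 (by linarith)
      _ = (R ^ (q - 3) * 2 ^ (-p)) ^ (1 + ε) := by
          rw [Real.mul_rpow (by positivity) (by positivity), ← Real.rpow_mul hR0.le,
            ← Real.rpow_mul two_pos.le]
      _ ≤ G ^ (1 + ε) := by gcongr
  · have hG : R ^ (q + 1) * ρ ^ (-p - 1 / 2) ≤ G := by
      refine le_trans ?_ hG2
      have h3 : ρ ^ (1 / 2 : ℝ) ≤ p * (R * r) := by
        rw [← Real.sqrt_eq_rpow, Real.sqrt_le_left (by positivity)]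
        have : 4 * (R * r) ^ 2 ≤ (p * (R * r)) ^ 2 := by
          rw [mul_pow p]; gcongr; nlinarith
        nlinarith
      calc R ^ (q + 1) * ρ ^ (-p - 1 / 2) = R ^ (q + 1) * (ρ ^ (-p - 1) * ρ ^ (1 / 2 : ℝ)) := by
            rw [← Real.rpow_add hρ0]; ring_nf
        _ ≤ R ^ (q + 1) * (ρ ^ (-p - 1) * (p * (R * r))) := by gcongr
        _ = _ := by rw [Real.rpow_add_one hR0.ne']; ring
    calc C * (R ^ (q + 2) * ρ ^ (-p - 2))
        = (C * 5 ^ m) * 5 ^ (-m) * (R ^ (q + 2) * ρ ^ (-p - 2)) := by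
          rw [Real.rpow_neg (by norm_num)]
          field_simp
      _ ≤ R * 5 ^ (-m) * (R ^ (q + 2) * ρ ^ (-p - 2)) := by gcongr
      _ = R ^ (q + 3 + 2 * m) * ((5 * R ^ 2) ^ (-m)) * ρ ^ (-p - 2) := by
          rw [Real.mul_rpow (by norm_num) (by positivity), ← Real.rpow_two,
            ← Real.rpow_mul hR0.le]
          have : R ^ (q + 3 + 2 * m) * R ^ (2 * -m) = R * R ^ (q + 2) := by
            rw [← Real.rpow_add hR0, mul_comm R, ← Real.rpow_add_one hR0.ne']; ring_nf
          linear_combination (-5 ^ (-m) * ρ ^ (-p - 2)) * this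
      _ ≤ R ^ (q + 3 + 2 * m) * ρ ^ (-m) * ρ ^ (-p - 2) := by
          gcongr _ * ?_ * _
          exact Real.rpow_le_rpow_of_nonpos hρ0 hρ5 (by linarith)
      _ = R ^ ((q + 1) * (1 + ε)) * ρ ^ ((-p - 1 / 2) * (1 + ε)) := by
          rw [mul_assoc, ← Real.rpow_add hρ0, hm]
          congr 2 <;> linarith
      _ = (R ^ (q + 1) * ρ ^ (-p - 1 / 2)) ^ (1 + ε) := by
          rw [Real.mul_rpow (by positivity) (by positivity), ← Real.rpow_mul hR0.le,
            ← Real.rpow_mul hρ0.le]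
      _ ≤ G ^ (1 + ε) := by gcongr

lemma tendsto_integral_inv_rpow_add_atTop {ε : ℝ} (hε : 0 < ε) {m M : ℕ → ℝ}
    (hm0 : ∀ k, 0 < m k) (hm : Tendsto m atTop (nhds 0)) (hM : ∀ k, 1 ≤ M k) :
    Tendsto (fun k => ∫ s in (m k)..(M k), (s ^ (1 + ε) + s)⁻¹) atTop atTop := by
  have hlog : Tendsto (fun k => (1 / 2) * (-Real.log (m k))) atTop atTop := by
    refine Tendsto.const_mul_atTop (by norm_num) (tendsto_neg_atBot_atTop.comp ?_)
    exact Real.tendsto_log_nhdsGT_zero.comp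
      (tendsto_nhdsWithin_iff.2 ⟨hm, Eventually.of_forall hm0⟩)
  refine tendsto_atTop_mono' _ ?_ hlog
  filter_upwards [hm.eventually_lt_const one_pos] with k hk
  have hint {a b : ℝ} (ha : 0 < a) (hab : a ≤ b) :
      IntervalIntegrable (fun s : ℝ => (s ^ (1 + ε) + s)⁻¹) MeasureTheory.volume a b := by
    refine ContinuousOn.intervalIntegrable fun s hs => ContinuousAt.continuousWithinAt ?_
    rw [uIcc_of_le hab] at hs
    have hs0 : 0 < s := ha.trans_le hs.1
    exact ((Real.continuousAt_rpow_const s _ (Or.inl hs0.ne')).add continuousAt_id).inv₀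
      (ne_of_gt (add_pos (Real.rpow_pos_of_pos hs0 _) hs0))
  rw [← intervalIntegral.integral_add_adjacent_intervals (hint (hm0 k) hk.le)
    (hint one_pos (hM k))]
  have h2 : 0 ≤ ∫ s in (1 : ℝ)..(M k), (s ^ (1 + ε) + s)⁻¹ := by
    refine intervalIntegral.integral_nonneg (hM k) fun s hs => ?_
    have hs0 : 0 < s := one_pos.trans_le hs.1
    positivity
  have h1 : (1 / 2) * (-Real.log (m k)) = ∫ s in (m k)..1, (1 / 2) * s⁻¹ := by
    rw [intervalIntegral.integral_const_mul, integral_inv_of_pos (hm0 k) one_pos, one_div (m k),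
      Real.log_inv]
  have h3 : ∫ s in (m k)..1, (1 / 2) * s⁻¹ ≤ ∫ s in (m k)..1, (s ^ (1 + ε) + s)⁻¹ := by
    refine intervalIntegral.integral_mono_on hk.le ?_ (hint (hm0 k) hk.le) fun s hs => ?_
    · refine (intervalIntegral.intervalIntegrable_inv (fun s hs => ?_) continuousOn_id).const_mul _
      rw [uIcc_of_le hk.le] at hs
      exact ((hm0 k).trans_le hs.1).ne'
    · have hs0 : 0 < s := (hm0 k).trans_le hs.1
      have : s ^ (1 + ε) ≤ s := by
        simpa using Real.rpow_le_rpow_of_exponent_ge hs0 hs.2 (by linarith : (1 : ℝ) ≤ 1 + ε)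
      rw [one_div, ← mul_inv]
      exact inv_anti₀ (by positivity) (by linarith)
  linarith

section SpikeValues

variable {n : ℕ} (i₀ : Fin n) {A R p : ℝ}

lemma spike_coeff_mem_Icc (hR : 2 ≤ R) {x : EuclideanSpace ℝ (Fin n)} (hx : ‖x‖ < 2) :
    1 + (R ^ 3)⁻¹ * x i₀ ∈ Icc (1 / 2 : ℝ) 2 := by
  have h1 : |x i₀| < 2 := (PiLp.norm_apply_le x i₀).trans_lt hx
  have h2 : (R ^ 3)⁻¹ ≤ 1 / 8 := by
    rw [one_div]
    exact inv_anti₀ (by norm_num) (by nlinarith [pow_le_pow_left₀ two_pos.le hR 3])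
  have h3 : |(R ^ 3)⁻¹ * x i₀| ≤ 1 / 8 * 2 := by
    rw [abs_mul, abs_of_nonneg (by positivity : (0 : ℝ) ≤ (R ^ 3)⁻¹)]
    gcongr
  rw [abs_le] at h3
  constructor <;> linarith

lemma le_spike (hA : 0 ≤ A) (hp : 0 ≤ p) (hR : 2 ≤ R) {x : EuclideanSpace ℝ (Fin n)}
    (hx : ‖x‖ < 2) :
    A * (1 / 2) * (5 * R ^ 2) ^ (-p) ≤ spike i₀ A (R ^ 3)⁻¹ (R ^ 2) p x := by
  have hc := (spike_coeff_mem_Icc i₀ hR hx).1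
  have h1 : (5 * R ^ 2) ^ (-p) ≤ spikeWeight i₀ (R ^ 2) x ^ (-p) :=
    Real.rpow_le_rpow_of_nonpos (spikeWeight_pos i₀ (sq_nonneg R) x)
      (spikeWeight_le i₀ (by linarith) hx) (by linarith)
  unfold spike
  have hc0 : 0 ≤ 1 + (R ^ 3)⁻¹ * x i₀ := by linarith
  gcongr

lemma spike_le (hA : 0 ≤ A) (hp : 0 ≤ p) (hR : 2 ≤ R) {x : EuclideanSpace ℝ (Fin n)}
    (hx : ‖x‖ < 2) : spike i₀ A (R ^ 3)⁻¹ (R ^ 2) p x ≤ A * 2 := by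
  have hc := (spike_coeff_mem_Icc i₀ hR hx).2
  have hw := one_le_spikeWeight i₀ (sq_nonneg R) x
  have h1 : spikeWeight i₀ (R ^ 2) x ^ (-p) ≤ 1 :=
    Real.rpow_le_one_of_one_le_of_nonpos hw (by linarith)
  calc _ ≤ A * 2 * 1 := by
        unfold spike
        gcongr
    _ = A * 2 := mul_one _

lemma spike_zero : spike i₀ A (R ^ 3)⁻¹ (R ^ 2) p 0 = A := by
  simp [spike, spikeWeight]

lemma spike_single_le {i₁ : Fin n} (hi : i₁ ≠ i₀) (hA : 0 ≤ A) (hp : 0 ≤ p) (hR : 0 < R) :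
    spike i₀ A (R ^ 3)⁻¹ (R ^ 2) p (EuclideanSpace.single i₁ (1 / 2)) ≤
      A * (R ^ 2 / 4) ^ (-p) := by
  have h0 : (EuclideanSpace.single i₁ (1 / 2 : ℝ)) i₀ = 0 := by simp [hi.symm]
  have h1 : (R ^ 2 / 4) ≤ spikeWeight i₀ (R ^ 2) (EuclideanSpace.single i₁ (1 / 2)) := by
    rw [spikeWeight, perp_apply, h0, zero_smul, sub_zero, PiLp.norm_single]
    norm_num
    linarith
  unfold spike
  rw [h0, mul_zero, add_zero, mul_one]
  exact mul_le_mul_of_nonneg_left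
    (Real.rpow_le_rpow_of_nonpos (by positivity) h1 (by linarith)) hA

end SpikeValues

/-- **Theorem 1.1.** For `n ≥ 3` and any `ε₀ > 0` there exist ellipticity
constants `0 < λ ≤ Λ` and a sequence of positive functions `u_k ∈ C²(B₂)` with
`|P⁻_{λ,Λ}(D²u_k)| ≤ |Du_k|^{1+ε₀}` pointwise in `B₂`, while `m_k = inf_{B₁} u_k → 0`,
`M_k = sup_{B₁} u_k ≥ 1`, and `∫_{m_k}^{M_k} ds/(s^{1+ε₀}+s) → ∞`. -/
theorem harnack_fails_for_power_nonlinearity (n : ℕ) (hn : 3 ≤ n) (ε₀ : ℝ) (hε₀ : 0 < ε₀) :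
    ∃ lam Lam : ℝ, 0 < lam ∧ lam ≤ Lam ∧
      ∃ u : ℕ → EuclideanSpace ℝ (Fin n) → ℝ,
        (∀ k, ∀ x ∈ Metric.ball (0 : EuclideanSpace ℝ (Fin n)) 2, 0 < u k x) ∧
        (∀ k, ContDiffOn ℝ 2 (u k) (Metric.ball 0 2)) ∧
        (∀ k, ∀ x ∈ Metric.ball (0 : EuclideanSpace ℝ (Fin n)) 2,
          |pucciMinus lam Lam (hessian (u k) x)| ≤ ‖gradient (u k) x‖ ^ (1 + ε₀)) ∧
        Filter.Tendsto (fun k => sInf (u k '' Metric.ball 0 1)) Filter.atTop (nhds 0) ∧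
        (∀ k, 1 ≤ sSup (u k '' Metric.ball 0 1)) ∧
        Filter.Tendsto
          (fun k => ∫ s in (sInf (u k '' Metric.ball 0 1))..(sSup (u k '' Metric.ball 0 1)),
            (s ^ (1 + ε₀) + s)⁻¹)
          Filter.atTop Filter.atTop := by
  obtain ⟨p, hp⟩ : ∃ p : ℝ, p = n + 7 / ε₀ + 3 := ⟨_, rfl⟩
  obtain ⟨q, hq⟩ : ∃ q : ℝ, q = 2 * p - 1 / ε₀ := ⟨_, rfl⟩
  have hn' : (3 : ℝ) ≤ n := by exact_mod_cast hn
  have hε1 : 0 < 1 / ε₀ := by positivity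
  have hε7 : 7 / ε₀ = 7 * (1 / ε₀) := by ring
  have hp2 : 2 ≤ p := by rw [hp, hε7]; linarith
  have hp0 : 0 ≤ p := by linarith
  have hpε : p * ε₀ = n * ε₀ + 7 + 3 * ε₀ := by rw [hp]; field_simp
  have hpq : q * ε₀ = 2 * p * ε₀ - 1 := by rw [hq]; field_simp
  have hq0 : 0 ≤ q := by rw [hq, hp, hε7]; linarith
  have hnε : 0 ≤ n * ε₀ := by positivity
  obtain ⟨L, hL⟩ : ∃ L : ℝ, L = (2 * p + 1) / (n - 2) := ⟨_, rfl⟩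
  have hLp : L * (n - 2) = 2 * p + 1 := by
    rw [hL, div_mul_cancel₀]
    linarith
  have hL1 : 1 ≤ L := by
    rw [hL, one_le_div (by linarith), hp, hε7]
    linarith
  obtain ⟨R₀, hR₀, hest⟩ := exists_forall_le_rpow_of_gradient_bounds (ε := ε₀) (p := p) (q := q)
    (100 * L * (p + 1) * p) hε₀ (by positivity) hp2 (by linarith) hpq
  let i₀ : Fin n := ⟨0, by omega⟩
  let i₁ : Fin n := ⟨1, by omega⟩
  have hi : i₁ ≠ i₀ := by simp [i₀, i₁]
  obtain ⟨R, hR⟩ : ∃ R : ℕ → ℝ, R = fun k : ℕ => R₀ + (k : ℝ) := ⟨_, rfl⟩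
  have hRR₀ (k : ℕ) : R₀ ≤ R k := by simp [hR]
  have hR2 (k : ℕ) : 2 ≤ R k := hR₀.trans (hRR₀ k)
  have hRpos (k : ℕ) : 0 < R k := two_pos.trans_le (hR2 k)
  have hRtop : Tendsto R atTop atTop := by
    rw [hR]
    exact tendsto_atTop_add_const_left _ _ tendsto_natCast_atTop_atTop
  have hA (k : ℕ) : 0 ≤ R k ^ q := Real.rpow_nonneg (hRpos k).le _
  let u : ℕ → EuclideanSpace ℝ (Fin n) → ℝ :=
    fun k => spike i₀ (R k ^ q) (R k ^ 3)⁻¹ (R k ^ 2) p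
  have hball {x : EuclideanSpace ℝ (Fin n)} (hx : x ∈ Metric.ball 0 1) : ‖x‖ < 2 := by
    rw [mem_ball_zero_iff] at hx
    linarith
  have hlow (k : ℕ) : 0 < R k ^ q * (1 / 2) * (5 * R k ^ 2) ^ (-p) := by
    have := hRpos k
    positivity
  have hbdd (k : ℕ) : BddBelow (u k '' Metric.ball 0 1) :=
    ⟨_, forall_mem_image.2 fun x hx => le_spike i₀ (hA k) hp0 (hR2 k) (hball hx)⟩
  have hinf (k : ℕ) : 0 < sInf (u k '' Metric.ball 0 1) :=
    (hlow k).trans_le <| le_csInf ((Metric.nonempty_ball.2 one_pos).image _) <|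
      forall_mem_image.2 fun x hx => le_spike i₀ (hA k) hp0 (hR2 k) (hball hx)
  have hsup (k : ℕ) : 1 ≤ sSup (u k '' Metric.ball 0 1) := by
    refine le_trans ?_ (le_csSup
      ⟨_, forall_mem_image.2 fun x hx => spike_le i₀ (hA k) hp0 (hR2 k) (hball hx)⟩
      (mem_image_of_mem _ (Metric.mem_ball_self one_pos)))
    exact (Real.one_le_rpow (by linarith [hR2 k]) hq0).trans_eq (spike_zero i₀).symm
  have hlim : Tendsto (fun k => sInf (u k '' Metric.ball 0 1)) atTop (nhds 0) := by
    have hbound : Tendsto (fun k => 4 ^ p * R k ^ (-(1 / ε₀))) atTop (nhds 0) := by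
      simpa using ((tendsto_rpow_neg_atTop hε1).comp hRtop).const_mul (4 ^ p)
    refine squeeze_zero (fun k => (hinf k).le) (fun k => ?_) hbound
    have hmem : EuclideanSpace.single i₁ (1 / 2 : ℝ) ∈ Metric.ball 0 1 := by
      rw [mem_ball_zero_iff, PiLp.norm_single]
      norm_num
    refine (csInf_le (hbdd k) (mem_image_of_mem _ hmem)).trans
      ((spike_single_le i₀ hi (hA k) hp0 (hRpos k)).trans_eq ?_)
    rw [Real.div_rpow (by positivity) (by norm_num), Real.rpow_neg (by norm_num : (0 : ℝ) ≤ 4),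
      div_inv_eq_mul, ← Real.rpow_two, ← Real.rpow_mul (hRpos k).le, ← mul_assoc,
      ← Real.rpow_add (hRpos k), mul_comm, hq]
    ring_nf
  refine ⟨1, L, one_pos, hL1, u, fun k x hx => ?_, fun k => ?_, fun k x hx => ?_, hlim, hsup,
    tendsto_integral_inv_rpow_add_atTop hε₀ hinf hlim hsup⟩
  · rw [mem_ball_zero_iff] at hx
    exact (hlow k).trans_le (le_spike i₀ (hA k) hp0 (hR2 k) hx)
  · exact (contDiff_spike i₀ (sq_nonneg _)).contDiffOn
  · rw [mem_ball_zero_iff] at hx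
    have hR1 : 1 ≤ R k := by linarith [hR2 k]
    obtain ⟨hc1, hc2⟩ := spike_coeff_mem_Icc i₀ (hR2 k) hx
    have hρ1 := one_le_spikeWeight i₀ (sq_nonneg (R k)) x
    refine (abs_pucciMinus_hessian_spike_le i₀ (hA k) hp0 hR1
      (inv_mul_cancel₀ (pow_pos (hRpos k) 3).ne') hL1 hLp hx (by linarith) hc2).trans ?_
    refine hest (R k) (hRR₀ k) _ ‖perp i₀ x‖ _ hρ1 (spikeWeight_le i₀ hR1 hx) (norm_nonneg _) rfl
      (norm_gradient_spike_ge_axial i₀ (sq_nonneg _) x)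
      (le_trans ?_ (norm_gradient_spike_ge_radial i₀ (sq_nonneg _) x))
    have hw : 0 ≤ p * R k ^ q * R k ^ 2 * spikeWeight i₀ (R k ^ 2) x ^ (-p - 1) * ‖perp i₀ x‖ := by
      have := hA k
      have := Real.rpow_nonneg (zero_le_one.trans hρ1) (-p - 1)
      positivity
    nlinarith
end

section
/- Let u ∈ C(Q₄(0,1)) be a non-negative viscosity supersolution of P⁻_{λ,Λ}(D²u) − u_t ≤ φ(|Du|) and a viscosity subsolution of P⁺_{λ,Λ}(D²u) − u_t ≥ −φ(|Du|) in Q₄(0,1) ⊂ ℝⁿ×ℝ, and assume that φ satisfies the Osgood condition ∫₀¹ ds/φ(s) = ∞. If u(0,0) = 0, then u(x,0) = 0 for all x ∈ B₁. -/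
open Set Filter

/-- Pucci maximal operator `P⁺_{λ,Λ}`. -/
noncomputable def pucciPlus {n : ℕ} (lam Lam : ℝ) (M : Matrix (Fin n) (Fin n) ℝ) : ℝ :=
  letI := Classical.propDecidable M.IsHermitian
  if h : M.IsHermitian then
    Lam * ∑ i, max (h.eigenvalues i) 0 + lam * ∑ i, min (h.eigenvalues i) 0
  else 0

/-- Parabolic cube `Q_ρ(x₀,t₀)`. -/
def pcube {n : ℕ} (x₀ : EuclideanSpace ℝ (Fin n)) (t₀ ρ : ℝ) :
    Set (EuclideanSpace ℝ (Fin n) × ℝ) :=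
  {p | (∀ i, |p.1 i - x₀ i| < ρ) ∧ p.2 ∈ Set.Ioc (t₀ - ρ ^ 2) t₀}

/-- Spatial Hessian of `ψ(x,t)` in the `x` variable. -/
noncomputable def spatialHessian {n : ℕ} (ψ : EuclideanSpace ℝ (Fin n) × ℝ → ℝ)
    (p : EuclideanSpace ℝ (Fin n) × ℝ) : Matrix (Fin n) (Fin n) ℝ :=
  hessian (fun y => ψ (y, p.2)) p.1

/-- Spatial gradient of `ψ(x,t)` in the `x` variable. -/
noncomputable def spatialGrad {n : ℕ} (ψ : EuclideanSpace ℝ (Fin n) × ℝ → ℝ)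
    (p : EuclideanSpace ℝ (Fin n) × ℝ) : EuclideanSpace ℝ (Fin n) :=
  gradient (fun y => ψ (y, p.2)) p.1

/-- Time derivative `ψ_t`. -/
noncomputable def timeDeriv {n : ℕ} (ψ : EuclideanSpace ℝ (Fin n) × ℝ → ℝ)
    (p : EuclideanSpace ℝ (Fin n) × ℝ) : ℝ :=
  deriv (fun s => ψ (p.1, s)) p.2

/-- Viscosity supersolution of `P⁻_{λ,Λ}(D²u) − u_t ≤ φ(|Du|)` in `Q`. -/
def IsViscositySupersol {n : ℕ} (lam Lam : ℝ) (φ : ℝ → ℝ)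
    (Q : Set (EuclideanSpace ℝ (Fin n) × ℝ)) (u : EuclideanSpace ℝ (Fin n) × ℝ → ℝ) : Prop :=
  ∀ p ∈ Q, ∀ ψ : EuclideanSpace ℝ (Fin n) × ℝ → ℝ, ContDiffOn ℝ 2 ψ Q →
    (∀ q ∈ Q, ψ q ≤ u q) → ψ p = u p →
    pucciMinus lam Lam (spatialHessian ψ p) - timeDeriv ψ p ≤ φ ‖spatialGrad ψ p‖

/-- Viscosity subsolution of `P⁺_{λ,Λ}(D²u) − u_t ≥ −φ(|Du|)` in `Q`. -/
def IsViscositySubsol {n : ℕ} (lam Lam : ℝ) (φ : ℝ → ℝ)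
    (Q : Set (EuclideanSpace ℝ (Fin n) × ℝ)) (u : EuclideanSpace ℝ (Fin n) × ℝ → ℝ) : Prop :=
  ∀ p ∈ Q, ∀ ψ : EuclideanSpace ℝ (Fin n) × ℝ → ℝ, ContDiffOn ℝ 2 ψ Q →
    (∀ q ∈ Q, u q ≤ ψ q) → ψ p = u p →
    -φ ‖spatialGrad ψ p‖ ≤ pucciPlus lam Lam (spatialHessian ψ p) - timeDeriv ψ p

/-- The structural conditions (P1)–(P3) on the nonlinearity `φ(t) = η(t)·t`. -/
structure PhiEta (φ η : ℝ → ℝ) (Λ₀ : ℝ) : Prop where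
  phi_eq : ∀ t > 0, φ t = η t * t
  phi_zero : φ 0 = 0
  phi_mono : MonotoneOn φ (Set.Ici 0)
  phi_lip : LocallyLipschitzOn (Set.Ioi 0) φ
  phi_ge : ∀ t ≥ 0, t ≤ φ t
  eta_ge_one : ∀ t > 0, 1 ≤ η t
  eta_anti : AntitoneOn η (Set.Ioo 0 1)
  eta_mono : MonotoneOn η (Set.Ici 1)
  cond_P2 : Filter.Tendsto (fun t => t * deriv η t / η t * Real.log (η t))
      Filter.atTop (nhds 0)
  lam0_ge_one : 1 ≤ Λ₀
  cond_P3 : ∀ s > 0, ∀ t > 0, η (s * t) ≤ Λ₀ * η s * η t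

/-- The region `A⁺_ρ(x₀,t₀)` (with dimensional constant `c = c_n`). -/
def aPlus {n : ℕ} (c : ℝ) (x₀ : EuclideanSpace ℝ (Fin n)) (t₀ ρ : ℝ) :
    Set (EuclideanSpace ℝ (Fin n) × ℝ) :=
  {p | (∀ i, |p.1 i - x₀ i| < ρ * c / 2) ∧
    p.2 - t₀ ∈ Set.Ioc (ρ ^ 2 - (ρ * c) ^ 2 / 2) (ρ ^ 2 - (ρ * c) ^ 2 / 4)}

lemma exists_osgood_profile {φ : ℝ → ℝ} (hcont : ContinuousOn φ (Ioi 0))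
    (hge : ∀ t > 0, t ≤ φ t)
    (hOsgood : ∫⁻ s in Ioo (0 : ℝ) 1, ENNReal.ofReal (φ s)⁻¹ = ⊤)
    {K ε : ℝ} (hK : 0 < K) (hε : 0 < ε) :
    ∃ v v' : ℝ → ℝ, Continuous v' ∧ (∀ s, HasDerivAt v (v' s) s) ∧ (∀ s, 0 < v s) ∧
      ∀ s ≤ 1, v s ≤ ε ∧ v' s = K * φ (v s) := by
  have hpos : ∀ t > 0, 0 < φ t := fun t ht => ht.trans_le (hge t ht)
  set h : ℝ → ℝ := fun w => Real.exp w / (K * φ (Real.exp (min w 0))) with hh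
  have hφc : Continuous fun w : ℝ => φ (Real.exp (min w 0)) :=
    hcont.comp_continuous (by fun_prop) fun w => Real.exp_pos _
  have hden : ∀ w : ℝ, 0 < K * φ (Real.exp (min w 0)) := fun w =>
    mul_pos hK (hpos _ (Real.exp_pos _))
  have hhpos : ∀ w, 0 < h w := fun w => div_pos (Real.exp_pos _) (hden w)
  have hhc : Continuous h :=
    Real.continuous_exp.div (continuous_const.mul hφc) fun w => (hden w).ne'
  set H : ℝ → ℝ := fun w => ∫ s in (0 : ℝ)..w, h s with hH
  have hHd : ∀ w, HasDerivAt H (h w) w := fun w =>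
    (hhc.integral_hasStrictDerivAt 0 w).hasDerivAt
  have hHmono : StrictMono H := strictMono_of_hasDerivAt_pos hHd hhpos
  have hHc : Continuous H := continuous_iff_continuousAt.2 fun w => (hHd w).continuousAt
  have htop : Tendsto H atTop atTop := by
    have h1 : ∀ w ≥ 0, (K * φ 1)⁻¹ * w ≤ H w := by
      intro w hw
      have : ∫ s in (0 : ℝ)..w, (K * φ 1)⁻¹ ≤ H w := by
        apply intervalIntegral.integral_mono_on hw (by simp) (hhc.intervalIntegrable _ _)
        intro s hs
        simp only [hh, min_eq_right hs.1, Real.exp_zero, div_eq_mul_inv]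
        have : 0 < (K * φ 1)⁻¹ := inv_pos.2 (mul_pos hK (hpos 1 one_pos))
        nlinarith [Real.one_le_exp hs.1]
      simpa [mul_comm, mul_left_comm] using this
    exact tendsto_atTop_mono' _ (eventually_ge_atTop 0 |>.mono h1)
      (tendsto_id.const_mul_atTop (inv_pos.2 (mul_pos hK (hpos 1 one_pos))))
  have hbot : Tendsto H atBot atBot := by
    apply hHmono.monotone.tendsto_atBot_atBot
    by_contra! hc
    obtain ⟨b, hb⟩ := hc
    have hint : MeasureTheory.IntegrableOn h (Iic 0) := by
      refine MeasureTheory.integrableOn_Iic_of_intervalIntegral_norm_bounded (-b) 0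
        (a := id) (l := atBot) (fun i => (hhc.integrableOn_Icc).mono_set Ioc_subset_Icc_self)
        tendsto_id ?_
      filter_upwards with w
      simp only [Real.norm_of_nonneg (hhpos _).le, id]
      rw [intervalIntegral.integral_symm]
      exact neg_le_neg (hb w).le
    have himg : Ioo (0 : ℝ) 1 = Real.exp '' Iio 0 := by
      rw [← Real.exp_zero, Real.image_exp_Iio]
    rw [himg, MeasureTheory.lintegral_image_eq_lintegral_abs_deriv_mul measurableSet_Iio
      (fun x _ => (Real.hasDerivAt_exp x).hasDerivWithinAt) Real.exp_injective.injOn] at hOsgood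
    have hint' : MeasureTheory.IntegrableOn (fun w => K * h w) (Iio 0) :=
      (hint.mono_set Iio_subset_Iic_self).const_mul K
    refine hint'.lintegral_lt_top.ne (Eq.trans ?_ hOsgood)
    refine MeasureTheory.setLIntegral_congr_fun measurableSet_Iio fun w hw => ?_
    have hw' : w < 0 := hw
    simp only [hh]
    rw [abs_of_pos (Real.exp_pos w), ← ENNReal.ofReal_mul (Real.exp_pos w).le,
      min_eq_left hw'.le]
    have := (hpos _ (Real.exp_pos w)).ne'
    congr 1
    field_simp
  have hsurj : Function.Surjective H := hHc.surjective htop hbot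
  set e := hHmono.orderIsoOfSurjective H hsurj
  set W : ℝ → ℝ := fun s => e.symm s
  have hHW : ∀ s, H (W s) = s := fun s => e.apply_symm_apply s
  have hWc : Continuous W := e.symm.continuous
  have hWd : ∀ s, HasDerivAt W (h (W s))⁻¹ s := fun s =>
    HasDerivAt.of_local_left_inverse hWc.continuousAt (hHd (W s)) (hhpos _).ne'
      (Eventually.of_forall hHW)
  set a : ℝ := min (Real.log ε) 0
  have hWa : ∀ s ≤ 1, W (s - 1 + H a) ≤ a := by
    intro s hs
    rw [← hHmono.le_iff_le, hHW]
    linarith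
  refine ⟨fun s => Real.exp (W (s - 1 + H a)),
    fun s => K * φ (Real.exp (min (W (s - 1 + H a)) 0)), ?_, ?_, fun s => Real.exp_pos _, ?_⟩
  · exact continuous_const.mul (hφc.comp (hWc.comp (by fun_prop)))
  · intro s
    have h1 := (hWd (s - 1 + H a)).comp s (((hasDerivAt_id s).sub_const 1).add_const (H a))
    refine h1.exp.congr_deriv ?_
    rw [mul_one, ← div_eq_mul_inv]
    change Real.exp (W (s - 1 + H a)) / (Real.exp (W (s - 1 + H a)) / _) = _
    have := (Real.exp_pos (W (s - 1 + H a))).ne'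
    field_simp
  · intro s hs
    have h1 := hWa s hs
    constructor
    · rw [← Real.le_log_iff_exp_le hε]
      exact h1.trans (min_le_left _ _)
    · simp only [min_eq_left (h1.trans (min_le_right _ _))]

lemma le_pucciMinus_smul_vecMulVec_sub_smul_one {n : ℕ} {lam Lam a b : ℝ}
    (hLam : lam ≤ Lam) (ha : 0 ≤ a) (hb : 0 ≤ b) (y : Fin n → ℝ) :
    lam * (a * (y ⬝ᵥ y)) - Lam * (n * b) ≤
      pucciMinus lam Lam (a • Matrix.vecMulVec y y - b • (1 : Matrix (Fin n) (Fin n) ℝ)) := by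
  set M := a • Matrix.vecMulVec y y - b • (1 : Matrix (Fin n) (Fin n) ℝ) with hM
  have hH : M.IsHermitian := by
    ext i j
    simp [hM, Matrix.vecMulVec_apply, Matrix.one_apply, mul_comm, eq_comm]
  have htr : ∑ i, hH.eigenvalues i = a * (y ⬝ᵥ y) - n * b := by
    have := hH.trace_eq_sum_eigenvalues
    simp only [RCLike.ofReal_real_eq_id, id] at this
    rw [← this, hM]
    simp [Matrix.trace_sub, Matrix.trace_smul, Matrix.trace_vecMulVec, mul_comm]
  have hge : ∀ i, -b ≤ hH.eigenvalues i := by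
    intro i
    have hpsd : (M - (-b) • (1 : Matrix (Fin n) (Fin n) ℝ)).PosSemidef := by
      have : M - (-b) • (1 : Matrix (Fin n) (Fin n) ℝ) = a • Matrix.vecMulVec y (star y) := by
        simp [hM]
      rw [this]
      exact (Matrix.posSemidef_vecMulVec_self_star y).smul ha
    rw [hH.eigenvalues_eq]
    have h1 := hpsd.re_dotProduct_nonneg (hH.eigenvectorBasis i)
    have h2 : star (hH.eigenvectorBasis i : Fin n → ℝ) ⬝ᵥ
        (hH.eigenvectorBasis i : Fin n → ℝ) = 1 := by
      have h := hH.eigenvectorBasis.orthonormal.1 i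
      rw [EuclideanSpace.norm_eq, Real.sqrt_eq_one] at h
      simpa [dotProduct, pow_two] using h
    have h3 : (M - (-b) • (1 : Matrix (Fin n) (Fin n) ℝ)).mulVec (hH.eigenvectorBasis i) =
        M.mulVec (hH.eigenvectorBasis i) + b • (hH.eigenvectorBasis i : Fin n → ℝ) := by
      rw [Matrix.sub_mulVec, Matrix.smul_mulVec, Matrix.one_mulVec, neg_smul, sub_neg_eq_add]
    rw [h3, dotProduct_add, dotProduct_smul, h2] at h1
    simp only [RCLike.re_to_real, smul_eq_mul, mul_one] at h1 ⊢
    linarith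
  have hsum : ∀ i, lam * hH.eigenvalues i - (Lam - lam) * b ≤
      lam * max (hH.eigenvalues i) 0 + Lam * min (hH.eigenvalues i) 0 := by
    intro i
    rcases le_total (hH.eigenvalues i) 0 with h | h
    · simp only [max_eq_right h, min_eq_left h]; nlinarith [hge i]
    · simp only [max_eq_left h, min_eq_right h]; nlinarith
  have := Finset.sum_le_sum fun i (_ : i ∈ Finset.univ) => hsum i
  rw [Finset.sum_sub_distrib, ← Finset.mul_sum, htr, Finset.sum_add_distrib,
    ← Finset.mul_sum (f := fun i => max (hH.eigenvalues i) 0),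
    ← Finset.mul_sum (f := fun i => min (hH.eigenvalues i) 0)] at this
  rw [pucciMinus, dif_pos hH]
  refine le_trans (le_of_eq ?_) this
  simp
  ring

lemma hasFDerivAt_comp_sub_norm_sq {n : ℕ} {g g' : ℝ → ℝ} (hg : ∀ s, HasDerivAt g (g' s) s)
    (c : ℝ) (x₁ x : EuclideanSpace ℝ (Fin n)) :
    HasFDerivAt (fun y : EuclideanSpace ℝ (Fin n) => g (c - ‖y - x₁‖ ^ 2))
      ((-2 * g' (c - ‖x - x₁‖ ^ 2)) • innerSL ℝ (x - x₁)) x := by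
  have h1 := (((hasFDerivAt_id x).sub_const x₁).norm_sq).const_sub c
  refine ((hg _).comp_hasFDerivAt x h1).congr_fderiv ?_
  ext v
  simp
  ring

lemma hessian_comp_sub_norm_sq {n : ℕ} {g g' g'' : ℝ → ℝ} (hg : ∀ s, HasDerivAt g (g' s) s)
    (hg' : ∀ s, HasDerivAt g' (g'' s) s) (c : ℝ) (x₁ x : EuclideanSpace ℝ (Fin n)) :
    hessian (fun y : EuclideanSpace ℝ (Fin n) => g (c - ‖y - x₁‖ ^ 2)) x =
      (4 * g'' (c - ‖x - x₁‖ ^ 2)) • Matrix.vecMulVec (x - x₁).ofLp (x - x₁).ofLp -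
        (2 * g' (c - ‖x - x₁‖ ^ 2)) • (1 : Matrix (Fin n) (Fin n) ℝ) := by
  ext i j
  have h1 : (fun y : EuclideanSpace ℝ (Fin n) =>
      fderiv ℝ (fun y : EuclideanSpace ℝ (Fin n) => g (c - ‖y - x₁‖ ^ 2)) y
        (EuclideanSpace.single i 1)) =
      fun y => -2 * g' (c - ‖y - x₁‖ ^ 2) * (y i - x₁ i) := by
    ext y
    rw [(hasFDerivAt_comp_sub_norm_sq hg c x₁ y).fderiv]
    simp [EuclideanSpace.inner_single_right]
  have h2 : HasFDerivAt (fun y : EuclideanSpace ℝ (Fin n) => y i - x₁ i)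
      (EuclideanSpace.proj i : EuclideanSpace ℝ (Fin n) →L[ℝ] ℝ) x :=
    (EuclideanSpace.proj i : EuclideanSpace ℝ (Fin n) →L[ℝ] ℝ).hasFDerivAt.sub_const _
  have h3 := ((hasFDerivAt_comp_sub_norm_sq hg' c x₁ x).const_mul (-2)).fun_mul h2
  simp only [hessian, Matrix.of_apply, h1]
  rw [h3.fderiv]
  by_cases hij : i = j
  · subst hij
    simp [EuclideanSpace.inner_single_right, Matrix.vecMulVec_apply]
    ring
  · simp [EuclideanSpace.inner_single_right, Matrix.vecMulVec_apply, hij]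
    ring

lemma norm_gradient_comp_sub_norm_sq {n : ℕ} {g g' : ℝ → ℝ}
    (hg : ∀ s, HasDerivAt g (g' s) s) (c : ℝ) (x₁ x : EuclideanSpace ℝ (Fin n)) :
    ‖gradient (fun y : EuclideanSpace ℝ (Fin n) => g (c - ‖y - x₁‖ ^ 2)) x‖ =
      2 * |g' (c - ‖x - x₁‖ ^ 2)| * ‖x - x₁‖ := by
  rw [gradient, LinearIsometryEquiv.norm_map, (hasFDerivAt_comp_sub_norm_sq hg c x₁ x).fderiv,
    norm_smul, innerSL_apply_norm]
  simp

/-- The profile of a barrier: on `(-∞, 1]` it satisfies a differential inequality strong enough to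
absorb the first-order terms, while staying below a prescribed height. -/
lemma exists_barrier_profile {φ : ℝ → ℝ} (hcont : ContinuousOn φ (Ioi 0))
    (hge : ∀ t > 0, t ≤ φ t)
    (hOsgood : ∫⁻ s in Ioo (0 : ℝ) 1, ENNReal.ofReal (φ s)⁻¹ = ⊤)
    {K m : ℝ} (hK : 0 < K) (hm : 0 < m) :
    ∃ g g' g'' : ℝ → ℝ, ContDiff ℝ 2 g ∧ (∀ s, HasDerivAt g (g' s) s) ∧
      (∀ s, HasDerivAt g' (g'' s) s) ∧ (∀ s, 0 < g' s) ∧ g 0 = 0 ∧ StrictMono g ∧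
      ∀ s ≤ 1, g s ≤ m ∧ 2 * g'' s = K * φ (2 * g' s) := by
  obtain ⟨v, v', hv'c, hv, hvpos, hvφ⟩ := exists_osgood_profile hcont hge hOsgood hK hm
  have hvc : Continuous v := continuous_iff_continuousAt.2 fun s => (hv s).continuousAt
  have hg' : ∀ s, HasDerivAt (fun s => v s / 2) (v' s / 2) s := fun s => (hv s).div_const 2
  have hg'c : Continuous fun s => v s / 2 := by fun_prop
  have hg : ∀ s, HasDerivAt (fun s => ∫ r in (0 : ℝ)..s, v r / 2) (v s / 2) s := fun s =>
    (hg'c.integral_hasStrictDerivAt 0 s).hasDerivAt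
  have hmono : StrictMono fun s => ∫ r in (0 : ℝ)..s, v r / 2 :=
    strictMono_of_hasDerivAt_pos hg fun s => half_pos (hvpos s)
  have hderiv1 : deriv (fun s => ∫ r in (0 : ℝ)..s, v r / 2) = fun s => v s / 2 :=
    funext fun s => (hg s).deriv
  have hderiv2 : deriv (fun s => v s / 2) = fun s => v' s / 2 :=
    funext fun s => (hg' s).deriv
  refine ⟨fun s => ∫ r in (0 : ℝ)..s, v r / 2, fun s => v s / 2, fun s => v' s / 2, ?_, hg, hg',
    fun s => half_pos (hvpos s), intervalIntegral.integral_same, hmono, fun s hs => ⟨?_, ?_⟩⟩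
  · rw [show (2 : WithTop ℕ∞) = 1 + 1 by norm_num, contDiff_succ_iff_deriv]
    refine ⟨fun s => (hg s).differentiableAt, by simp, ?_⟩
    rw [hderiv1, contDiff_one_iff_deriv, hderiv2]
    exact ⟨fun s => (hg' s).differentiableAt, by fun_prop⟩
  · refine (hmono.monotone hs).trans ?_
    have : ∫ r in (0 : ℝ)..1, v r / 2 ≤ ∫ r in (0 : ℝ)..1, m := by
      refine intervalIntegral.integral_mono_on zero_le_one (hg'c.intervalIntegrable _ _)
        (by simp) fun r hr => ?_
      linarith [(hvφ r hr.2).1, hvpos r]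
    simpa using this
  · have := (hvφ s hs).2
    simp only [mul_div_cancel₀ _ (two_ne_zero' ℝ)]
    exact this

/-- A profile solving the barrier differential equation yields a strict classical subsolution of the
Pucci inequality along a paraboloid, away from the axis. -/
lemma lt_pucciMinus_sub_timeDeriv_barrier {n : ℕ} {lam Lam : ℝ} (hlam : 0 < lam)
    (hLam : lam ≤ Lam) {φ : ℝ → ℝ} (hφ : MonotoneOn φ (Ici 0)) (hge : ∀ t > 0, t ≤ φ t)
    {g g' g'' : ℝ → ℝ} (hg : ∀ s, HasDerivAt g (g' s) s) (hg' : ∀ s, HasDerivAt g' (g'' s) s)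
    {k d : ℝ} (hd : 0 < d) (hk : 0 ≤ k) {x₁ : EuclideanSpace ℝ (Fin n)}
    {p : EuclideanSpace ℝ (Fin n) × ℝ} (hp1 : ‖p.1 - x₁‖ ≤ 1) (hfar : d ≤ ‖p.1 - x₁‖)
    (hp2 : |p.2| ≤ 1 / 2) (hG : 0 < g' ((1 - k * p.2 ^ 2) - ‖p.1 - x₁‖ ^ 2))
    (hgeq : 2 * g'' ((1 - k * p.2 ^ 2) - ‖p.1 - x₁‖ ^ 2) =
      (2 + Lam * n + k) / (2 * lam * d ^ 2) *
        φ (2 * g' ((1 - k * p.2 ^ 2) - ‖p.1 - x₁‖ ^ 2))) :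
    φ ‖spatialGrad (fun q => g ((1 - k * q.2 ^ 2) - ‖q.1 - x₁‖ ^ 2)) p‖ <
      pucciMinus lam Lam (spatialHessian (fun q => g ((1 - k * q.2 ^ 2) - ‖q.1 - x₁‖ ^ 2)) p) -
        timeDeriv (fun q => g ((1 - k * q.2 ^ 2) - ‖q.1 - x₁‖ ^ 2)) p := by
  have hLampos : 0 < Lam := hlam.trans_le hLam
  set s := (1 - k * p.2 ^ 2) - ‖p.1 - x₁‖ ^ 2
  set ψ : EuclideanSpace ℝ (Fin n) × ℝ → ℝ :=
    fun q => g ((1 - k * q.2 ^ 2) - ‖q.1 - x₁‖ ^ 2)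
  have hhess : spatialHessian (ψ) p = _ :=
    hessian_comp_sub_norm_sq hg hg' (1 - k * p.2 ^ 2) x₁ p.1
  have hgrad : ‖spatialGrad (ψ) p‖ = _ :=
    norm_gradient_comp_sub_norm_sq hg (1 - k * p.2 ^ 2) x₁ p.1
  have htime : timeDeriv (ψ) p =
      g' s * -(k * (2 * p.2)) := by
    have h1 : HasDerivAt (fun s : ℝ => (1 - k * s ^ 2) - ‖p.1 - x₁‖ ^ 2) (-(k * (2 * p.2))) p.2 := by
      simpa using (((hasDerivAt_pow 2 p.2).const_mul k).const_sub 1).sub_const (‖p.1 - x₁‖ ^ 2)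
    exact ((hg _).comp p.2 h1).deriv
  rw [hhess, hgrad, htime]
  have hφG := hge (2 * g' s) (by linarith)
  have hg''nn : 0 ≤ g'' s := by
    have : 0 ≤ (2 + Lam * n + k) / (2 * lam * d ^ 2) * φ (2 * g' s) :=
      mul_nonneg (by positivity) (by linarith)
    linarith
  have hP := le_pucciMinus_smul_vecMulVec_sub_smul_one (lam := lam) hLam
    (a := 4 * g'' s) (b := 2 * g' s) (by linarith) (by linarith) (p.1 - x₁).ofLp
  have hdot : (p.1 - x₁).ofLp ⬝ᵥ (p.1 - x₁).ofLp = ‖p.1 - x₁‖ ^ 2 := by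
    rw [EuclideanSpace.norm_sq_eq]
    simp [dotProduct, pow_two]
  rw [hdot] at hP
  have hφle : φ (2 * |g' s| * ‖p.1 - x₁‖) ≤ φ (2 * g' s) := by
    rw [abs_of_pos hG]
    exact hφ (mem_Ici.2 (by positivity)) (mem_Ici.2 (by positivity)) (by nlinarith)
  have hmain : (2 + Lam * n + k) * φ (2 * g' s) ≤ lam * (4 * g'' s * ‖p.1 - x₁‖ ^ 2) := by
    have h1 : (2 + Lam * n + k) * φ (2 * g' s) = lam * (4 * g'' s * d ^ 2) := by
      rw [show 4 * g'' s = 2 * (2 * g'' s) by ring, hgeq]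
      field_simp
    rw [h1]
    gcongr
  have ht : -(k * (2 * g' s)) ≤ -(g' s * -(k * (2 * p.2))) := by
    have h1 : 0 ≤ k * (2 * g' s) := by positivity
    have h2 := (abs_le.1 hp2).1
    nlinarith
  have hL : 0 ≤ Lam * n + k := by positivity
  nlinarith [mul_le_mul_of_nonneg_left hφG hL]

/-- **Corollary 1.5, strong minimum principle.** If `u` is a non-negative
continuous viscosity supersolution/subsolution pair in `Q₄(0,1)`, `φ` satisfies the
Osgood condition `∫₀¹ ds/φ(s) = ∞`, and `u(0,0) = 0`, then `u(·,0) ≡ 0` on `B₁`. -/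
theorem strong_minimum_principle (n : ℕ) (lam Lam : ℝ) (hlam : 0 < lam) (hLam : lam ≤ Lam)
    (φ η : ℝ → ℝ) (Λ₀ : ℝ) (hφη : PhiEta φ η Λ₀)
    (hOsgood : ∫⁻ s in Set.Ioo (0 : ℝ) 1, ENNReal.ofReal (φ s)⁻¹ = ⊤)
    (u : EuclideanSpace ℝ (Fin n) × ℝ → ℝ)
    (hu_cont : ContinuousOn u (pcube (0 : EuclideanSpace ℝ (Fin n)) 1 4))
    (hu_nonneg : ∀ p ∈ pcube (0 : EuclideanSpace ℝ (Fin n)) 1 4, 0 ≤ u p)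
    (hu_super : IsViscositySupersol lam Lam φ (pcube (0 : EuclideanSpace ℝ (Fin n)) 1 4) u)
    (hu_sub : IsViscositySubsol lam Lam φ (pcube (0 : EuclideanSpace ℝ (Fin n)) 1 4) u)
    (hu0 : u (0, 0) = 0) :
    ∀ x ∈ Metric.ball (0 : EuclideanSpace ℝ (Fin n)) 1, u (x, 0) = 0 := by
  by_contra! hc
  obtain ⟨x₁, hx₁, hux₁⟩ := hc
  rw [mem_ball_zero_iff] at hx₁
  have hcont : ContinuousOn φ (Ioi 0) := hφη.phi_lip.continuousOn
  have hge : ∀ t > 0, t ≤ φ t := fun t ht => hφη.phi_ge t ht.le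
  have hQ₁ : (x₁, (0 : ℝ)) ∈ pcube (0 : EuclideanSpace ℝ (Fin n)) 1 4 := by
    refine ⟨fun i => ?_, by norm_num⟩
    have := PiLp.norm_apply_le x₁ i
    rw [Real.norm_eq_abs] at this
    simp only [PiLp.zero_apply, sub_zero]
    linarith
  set m := u (x₁, 0) / 2 with hm
  have hmpos : 0 < m := half_pos ((hu_nonneg _ hQ₁).lt_of_ne' hux₁)
  obtain ⟨d, hd, hdu⟩ : ∃ d > 0, ∀ p ∈ pcube (0 : EuclideanSpace ℝ (Fin n)) 1 4,
      dist p (x₁, 0) < d → m < u p := by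
    have h1 := (hu_cont _ hQ₁).eventually (lt_mem_nhds (show m < u (x₁, 0) by linarith))
    obtain ⟨d, hd, h2⟩ := Metric.mem_nhdsWithin_iff.1 h1
    exact ⟨d, hd, fun p hp hpd => h2 ⟨hpd, hp⟩⟩
  set k : ℝ := 4 + 4 / d ^ 2 with hk
  have hk4 : 4 ≤ k := by simp only [hk]; linarith [show 0 < 4 / d ^ 2 by positivity]
  have hkd : 4 ≤ k * d ^ 2 := by
    have : 4 / d ^ 2 * d ^ 2 = 4 := by field_simp
    nlinarith [sq_nonneg d]
  have hLampos : 0 < Lam := hlam.trans_le hLam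
  obtain ⟨g, g', g'', hgC, hg, hg', hg'pos, hg0, hgmono, hgφ⟩ :=
    exists_barrier_profile hcont hge hOsgood (K := (2 + Lam * n + k) / (2 * lam * d ^ 2))
      (m := m) (by positivity) hmpos
  set ψ : EuclideanSpace ℝ (Fin n) × ℝ → ℝ :=
    fun q => g ((1 - k * q.2 ^ 2) - ‖q.1 - x₁‖ ^ 2) with hψ
  have hψC : ContDiff ℝ 2 ψ := by
    refine hgC.comp (ContDiff.sub (by fun_prop) ?_)
    exact (contDiff_fst.sub contDiff_const).norm_sq ℝ
  set E : Set (EuclideanSpace ℝ (Fin n) × ℝ) := {q | 0 ≤ (1 - k * q.2 ^ 2) - ‖q.1 - x₁‖ ^ 2}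
    with hE
  have hEb : ∀ q ∈ E, ‖q.1 - x₁‖ ≤ 1 ∧ |q.2| ≤ 1 / 2 ∧ |q.2| < d := by
    intro q hq
    simp only [hE, mem_ofPred_eq] at hq
    have h1 : k * q.2 ^ 2 ≤ 1 := by nlinarith [sq_nonneg ‖q.1 - x₁‖]
    refine ⟨?_, ?_, ?_⟩
    · nlinarith [norm_nonneg (q.1 - x₁), sq_nonneg q.2]
    · exact abs_le_of_sq_le_sq (by nlinarith [sq_nonneg q.2]) (by norm_num)
    · refine abs_lt_of_sq_lt_sq ?_ hd.le
      nlinarith [sq_nonneg q.2]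
  have hEQ : E ⊆ pcube (0 : EuclideanSpace ℝ (Fin n)) 1 4 := by
    intro q hq
    obtain ⟨h1, h2, -⟩ := hEb q hq
    refine ⟨fun i => ?_, ?_⟩
    · have h3 := PiLp.norm_apply_le q.1 i
      have h4 := norm_sub_norm_le q.1 x₁
      rw [Real.norm_eq_abs] at h3
      simp only [PiLp.zero_apply, sub_zero]
      linarith
    · rw [abs_le] at h2
      constructor <;> linarith
  have hEcomp : IsCompact E := by
    refine ((isCompact_closedBall x₁ 1).prod (isCompact_Icc (a := -(1 / 2 : ℝ)) (b := 1 / 2))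
      ).of_isClosed_subset (isClosed_le continuous_const (by fun_prop)) fun q hq => ?_
    obtain ⟨h1, h2, -⟩ := hEb q hq
    exact ⟨by rwa [mem_closedBall_iff_norm], abs_le.1 h2⟩
  have h0E : ((0 : EuclideanSpace ℝ (Fin n)), (0 : ℝ)) ∈ E := by
    simp only [hE, mem_ofPred_eq, zero_sub, norm_neg]
    nlinarith [norm_nonneg x₁]
  have hψ0 : 0 < ψ (0, 0) := by
    refine hg0.symm.trans_lt (hgmono ?_)
    simp only [zero_sub, norm_neg]
    nlinarith [norm_nonneg x₁]
  obtain ⟨p, hpE, hpmin⟩ := hEcomp.exists_isMinOn ⟨_, h0E⟩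
    ((hu_cont.mono hEQ).sub hψC.continuous.continuousOn)
  have hpmin' : ∀ q ∈ E, u p - ψ p ≤ u q - ψ q := fun q hq => hpmin hq
  set δ := u p - ψ p with hδ
  have hδneg : δ < 0 := by
    have := hpmin' _ h0E
    rw [hu0] at this
    linarith
  obtain ⟨hp1, hp2, hpd⟩ := hEb p hpE
  have hs1 : (1 - k * p.2 ^ 2) - ‖p.1 - x₁‖ ^ 2 ≤ 1 := by
    nlinarith [sq_nonneg p.2, sq_nonneg ‖p.1 - x₁‖]
  obtain ⟨hgm, hgeq⟩ := hgφ _ hs1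
  have hfar : d ≤ ‖p.1 - x₁‖ := by
    by_contra! hlt
    have h1 : m < u p := hdu p (hEQ hpE) (by
      rw [Prod.dist_eq, max_lt_iff, dist_eq_norm, Real.dist_eq, sub_zero]
      exact ⟨hlt, hpd⟩)
    have h2 : ψ p ≤ m := hgm
    linarith
  have htest := hu_super p (hEQ hpE) (fun q => ψ q + δ) (hψC.add contDiff_const).contDiffOn
    (fun q hq => by
      by_cases hqE : q ∈ E
      · linarith [hpmin' q hqE]
      · have h1 : ψ q < 0 := by
          exact (hgmono (not_le.1 hqE)).trans_eq hg0
        linarith [hu_nonneg q hq]) (by simp only [hδ]; ring)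
  exact htest.not_gt (lt_pucciMinus_sub_timeDeriv_barrier hlam hLam hφη.phi_mono hge
    (fun s => (hg s).add_const δ) hg' hd (by linarith) hp1 hfar hp2 (hg'pos _) hgeq)
end

section
/- Let q > 0, k > 0 and r ∈ (0,1). Set 𝓐 = ((8+6q+q²)/(8k))·r^{−q}, 𝓑 = (q(q+4)/(4k))·r^{−q−2}, 𝓒 = (q(q+2)/(8k))·r^{−q−4} and 𝓓 = r^{−q}/k. Let ρ : [0,∞) → ℝ be a smooth function supported in [0,r) with ρ ≡ 1 on [0,r/2], ρ' ≤ 0 on [0,r) and |ρ'| ≤ 4/r. Define u(x,z) = 𝓐 − 𝓑|x|² + 𝓒|x|⁴ + 𝓓(z+2)ρ(|x|) for x ∈ ℝ², z ∈ ℝ. Then for every (x,z) with r/2 ≤ |x| < r and z ∈ (−2,2), the full gradient Du(x,z) ∈ ℝ³ satisfies |Du(x,z)|² ≥ (q²/4)·r^{−2q−2}/k². -/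
open Set Filter

/-- If `f` is differentiable at `p` and restricts to `g` along the horizontal ray through `p`, then
the radial derivative of `f` is bounded by the norm of its gradient. -/
theorem abs_radial_deriv_le_norm_gradient {f : EuclideanSpace ℝ (Fin 3) → ℝ}
    {p : EuclideanSpace ℝ (Fin 3)} {s : ℝ} {g : ℝ → ℝ} {g' : ℝ}
    (hs : 0 < s) (hps : p 0 ^ 2 + p 1 ^ 2 = s ^ 2) (hf : DifferentiableAt ℝ f p)
    (hfg : ∀ t : ℝ, -1 < t → f (p + t • !₂[p 0, p 1, 0]) = g ((1 + t) * s))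
    (hg : HasDerivAt g g' s) :
    |g'| ≤ ‖gradient f p‖ := by
  set v : EuclideanSpace ℝ (Fin 3) := !₂[p 0, p 1, 0] with hv
  have hnorm : ‖v‖ = s := by
    rw [EuclideanSpace.norm_eq, ← Real.sqrt_sq hs.le, ← hps]
    simp [hv, Fin.sum_univ_three]
  have hline : HasDerivAt (fun t : ℝ => f (p + t • v)) (fderiv ℝ f p v) 0 :=
    hf.hasFDerivAt.hasLineDerivAt v
  have hray : HasDerivAt (fun t : ℝ => f (p + t • v)) (g' * s) 0 := by
    have hlin : HasDerivAt (fun t : ℝ => (1 + t) * s) s 0 := by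
      simpa using ((hasDerivAt_id (0 : ℝ)).const_add 1).mul_const s
    have hcomp : HasDerivAt (fun t : ℝ => g ((1 + t) * s)) (g' * s) 0 :=
      HasDerivAt.comp (h₂ := g) (0 : ℝ) (by simpa using hg) hlin
    refine hcomp.congr_of_eventuallyEq ?_
    filter_upwards [lt_mem_nhds (show (-1 : ℝ) < 0 by norm_num)] with t ht using hfg t ht
  have hinner : inner ℝ (gradient f p) v = g' * s := by
    rw [gradient, InnerProductSpace.toDual_symm_apply]
    exact hline.unique hray
  have hle := abs_real_inner_le_norm (gradient f p) v
  rw [hinner, hnorm, abs_mul, abs_of_pos hs] at hle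
  exact le_of_mul_le_mul_right hle hs

/-- Gradient lower bound on the annulus `r/2 ≤ |x| < r`, `z ∈ (−2,2)`,
for the comparison function
`u(x,z) = 𝓐 − 𝓑|x|² + 𝓒|x|⁴ + 𝓓(z+2)ρ(|x|)` on `ℝ³ = ℝ²ₓ × ℝ_z`, where
`𝓐 = ((8+6q+q²)/(8k)) r^{-q}`, `𝓑 = (q(q+4)/(4k)) r^{-q-2}`,
`𝓒 = (q(q+2)/(8k)) r^{-q-4}`, `𝓓 = r^{-q}/k`, and `ρ` is a smooth cutoff supported in
`[0,r)`, equal to `1` on `[0,r/2]`, with `ρ' ≤ 0` on `[0,r)` and `|ρ'| ≤ 4/r`. Then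
`|Du(x,z)|² ≥ (q²/4) r^{-2q-2}/k²`. -/
theorem gradient_lower_bound_annulus (q k r : ℝ) (hq : 0 < q) (hk : 0 < k)
    (hr : r ∈ Set.Ioo (0 : ℝ) 1)
    (ρ : ℝ → ℝ) (hρ_smooth : ContDiffOn ℝ (⊤ : ℕ∞) ρ (Set.Ici 0))
    (hρ_one : ∀ t ∈ Set.Icc (0 : ℝ) (r / 2), ρ t = 1)
    (hρ_supp : ∀ t, r ≤ t → ρ t = 0)
    (hρ'_nonpos : ∀ t ∈ Set.Ico (0 : ℝ) r, deriv ρ t ≤ 0)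
    (hρ'_bdd : ∀ t ∈ Set.Ici (0 : ℝ), |deriv ρ t| ≤ 4 / r)
    (u : EuclideanSpace ℝ (Fin 3) → ℝ)
    (hu : ∀ p : EuclideanSpace ℝ (Fin 3),
      u p = (8 + 6 * q + q ^ 2) / (8 * k) * r ^ (-q)
        - q * (q + 4) / (4 * k) * r ^ (-q - 2) * Real.sqrt ((p 0) ^ 2 + (p 1) ^ 2) ^ 2
        + q * (q + 2) / (8 * k) * r ^ (-q - 4) * Real.sqrt ((p 0) ^ 2 + (p 1) ^ 2) ^ 4
        + r ^ (-q) / k * (p 2 + 2) * ρ (Real.sqrt ((p 0) ^ 2 + (p 1) ^ 2))) :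
    ∀ p : EuclideanSpace ℝ (Fin 3),
      r / 2 ≤ Real.sqrt ((p 0) ^ 2 + (p 1) ^ 2) →
      Real.sqrt ((p 0) ^ 2 + (p 1) ^ 2) < r →
      p 2 ∈ Set.Ioo (-2 : ℝ) 2 →
      q ^ 2 / 4 * r ^ (-2 * q - 2) / k ^ 2 ≤ ‖gradient u p‖ ^ 2 := by
  intro p hp_lower hp_upper hz
  obtain ⟨hr0, -⟩ := hr
  obtain ⟨hz_lower, -⟩ := hz
  set s := Real.sqrt ((p 0) ^ 2 + (p 1) ^ 2) with hs_def
  have hs : 0 < s := by linarith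
  have hps : p 0 ^ 2 + p 1 ^ 2 = s ^ 2 := (Real.sq_sqrt (by positivity)).symm
  have hρ : DifferentiableAt ℝ ρ s :=
    (hρ_smooth.contDiffAt (Ici_mem_nhds hs)).differentiableAt (by simp)
  have hu_diff : DifferentiableAt ℝ u p := by
    have hcoord (i : Fin 3) :
        DifferentiableAt ℝ (fun y : EuclideanSpace ℝ (Fin 3) => y i) p := by fun_prop
    have hsqrt : DifferentiableAt ℝ
        (fun y : EuclideanSpace ℝ (Fin 3) => Real.sqrt ((y 0) ^ 2 + (y 1) ^ 2)) p :=
      (((hcoord 0).pow 2).add ((hcoord 1).pow 2)).sqrt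
        (ne_of_gt (by simpa [hps] using pow_pos hs 2))
    have hcut : DifferentiableAt ℝ
        (fun y : EuclideanSpace ℝ (Fin 3) => ρ (Real.sqrt ((y 0) ^ 2 + (y 1) ^ 2))) p :=
      DifferentiableAt.comp (g := ρ) p hρ hsqrt
    rw [funext hu]
    exact (((hsqrt.pow 2).const_mul _).const_sub _ |>.add ((hsqrt.pow 4).const_mul _)).add
      ((((hcoord 2).add_const 2).const_mul _).mul hcut)
  set A := (8 + 6 * q + q ^ 2) / (8 * k) * r ^ (-q)
  set B := q * (q + 4) / (4 * k) * r ^ (-q - 2) with hB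
  set C := q * (q + 2) / (8 * k) * r ^ (-q - 4) with hC
  set D := r ^ (-q) / k with hD
  have hg : HasDerivAt (fun t : ℝ => A - B * t ^ 2 + C * t ^ 4 + D * (p 2 + 2) * ρ t)
      (-2 * B * s + 4 * C * s ^ 3 + D * (p 2 + 2) * deriv ρ s) s := by
    have h := ((((hasDerivAt_pow 2 s).const_mul B).const_sub A).add
      ((hasDerivAt_pow 4 s).const_mul C)).add (hρ.hasDerivAt.const_mul (D * (p 2 + 2)))
    refine h.congr_deriv ?_
    push_cast
    ring
  have hgrad := abs_radial_deriv_le_norm_gradient hs hps hu_diff (fun t ht => by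
    have hsqrt : Real.sqrt ((p 0 + t * p 0) ^ 2 + (p 1 + t * p 1) ^ 2) = (1 + t) * s := by
      rw [show (p 0 + t * p 0) ^ 2 + (p 1 + t * p 1) ^ 2 = ((1 + t) * s) ^ 2 by
        rw [mul_pow, ← hps]; ring]
      exact Real.sqrt_sq (mul_nonneg (by linarith) hs.le)
    rw [hu]
    simp [hsqrt]) hg
  have hr_two : r ^ (-q - 2) = r ^ (-q - 4) * r ^ 2 := by
    rw [← Real.rpow_natCast, ← Real.rpow_add hr0]; norm_num; ring_nf
  have hr_one : r ^ (-q - 1) = r ^ (-q - 2) * r := by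
    rw [← Real.rpow_add_one hr0.ne']; ring_nf
  have hr_sq : r ^ (-2 * q - 2) = (r ^ (-q - 1)) ^ 2 := by
    rw [← Real.rpow_natCast, ← Real.rpow_mul hr0.le]; norm_num; ring_nf
  have hC0 : 0 ≤ C := by positivity
  have hD0 : 0 ≤ D := by positivity
  have hcut : D * (p 2 + 2) * deriv ρ s ≤ 0 :=
    mul_nonpos_of_nonneg_of_nonpos (mul_nonneg hD0 (by linarith)) (hρ'_nonpos s ⟨hs.le, hp_upper⟩)
  have hcoeff : -2 * B + 4 * C * s ^ 2 ≤ -(q / k * r ^ (-q - 2)) := by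
    have hCr : -2 * B + 4 * C * r ^ 2 = -(q / k * r ^ (-q - 2)) := by
      rw [hB, hC, hr_two]; field_simp; ring
    rw [← hCr]
    gcongr
  have hpoly : -2 * B * s + 4 * C * s ^ 3 ≤ -(q / (2 * k) * r ^ (-q - 1)) := by
    calc -2 * B * s + 4 * C * s ^ 3 = (-2 * B + 4 * C * s ^ 2) * s := by ring
      _ ≤ -(q / k * r ^ (-q - 2)) * s := by gcongr
      _ ≤ -(q / k * r ^ (-q - 2)) * (r / 2) :=
        mul_le_mul_of_nonpos_left hp_lower (neg_nonpos.mpr (by positivity))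
      _ = -(q / (2 * k) * r ^ (-q - 1)) := by rw [hr_one]; field_simp
  have hlower : q / (2 * k) * r ^ (-q - 1) ≤ ‖gradient u p‖ :=
    le_trans (by linarith) ((neg_le_abs _).trans hgrad)
  calc q ^ 2 / 4 * r ^ (-2 * q - 2) / k ^ 2 = (q / (2 * k) * r ^ (-q - 1)) ^ 2 := by
        rw [hr_sq]; field_simp; ring
    _ ≤ ‖gradient u p‖ ^ 2 := by gcongr
end

section
/- Let η : (0,∞) → [1,∞) be such that φ(t) := η(t)·t is increasing on (0,∞). Let C > 1, K ∈ ℕ, and let 0 < M₀ ≤ M₁ ≤ … ≤ M_K be a nondecreasing finite sequence of positive reals satisfying M_{i+1} ≤ C·M_i for every 0 ≤ i ≤ K−1. Then ∫ from M₀ to M_K of dt/(φ(t)+t) is at most (C−1)·Σ_{i=0}^{K−1} 1/(η(M_i)+1). -/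
/-- An antitone function on `[a, b]` has integral at most `(b - a) * f a`. -/
theorem AntitoneOn.intervalIntegral_le_sub_mul {f : ℝ → ℝ} {a b : ℝ} (hab : a ≤ b)
    (hf : AntitoneOn f (Set.Icc a b)) : ∫ t in a..b, f t ≤ (b - a) * f a := by
  have hint : IntervalIntegrable f MeasureTheory.volume a b :=
    AntitoneOn.intervalIntegrable (by rwa [Set.uIcc_of_le hab])
  calc ∫ t in a..b, f t ≤ ∫ _ in a..b, f a :=
        intervalIntegral.integral_mono_on hab hint intervalIntegrable_const
          fun t ht => hf (Set.left_mem_Icc.2 hab) ht ht.1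
    _ = (b - a) * f a := by simp

/-- If `φ(t) = η(t) t` is increasing with `η ≥ 1`, `C > 1` and
`0 < M₀ ≤ M₁ ≤ … ≤ M_K` satisfies `M_{i+1} ≤ C M_i`, then
`∫_{M₀}^{M_K} dt/(φ(t)+t) ≤ (C−1) ∑_{i=0}^{K−1} 1/(η(M_i)+1)`. -/
theorem integral_sum_bound (η φ : ℝ → ℝ) (hη_ge : ∀ t > 0, 1 ≤ η t)
    (hφ_eq : ∀ t > 0, φ t = η t * t) (hφ_mono : MonotoneOn φ (Set.Ioi 0))
    (C : ℝ) (hC : 1 < C) (K : ℕ) (M : ℕ → ℝ) (hM0 : 0 < M 0)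
    (hMmono : ∀ i < K, M i ≤ M (i + 1)) (hMgrow : ∀ i < K, M (i + 1) ≤ C * M i) :
    ∫ t in (M 0)..(M K), (φ t + t)⁻¹ ≤
      (C - 1) * ∑ i ∈ Finset.range K, (η (M i) + 1)⁻¹ := by
  have hpos : ∀ i ≤ K, 0 < M i := by
    intro i
    induction i with
    | zero => exact fun _ => hM0
    | succ n ih => exact fun hn => (ih (by omega)).trans_le (hMmono n hn)
  have hanti : AntitoneOn (fun t => (φ t + t)⁻¹) (Set.Ioi 0) := by
    intro s hs t ht hst
    have hs' : 0 < s := hs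
    have hφs : 0 < φ s := by
      rw [hφ_eq s hs']
      exact mul_pos (zero_lt_one.trans_le (hη_ge s hs')) hs'
    exact inv_anti₀ (by positivity) (add_le_add (hφ_mono hs ht hst) hst)
  have hanti_Icc : ∀ i < K, AntitoneOn (fun t => (φ t + t)⁻¹) (Set.Icc (M i) (M (i + 1))) :=
    fun i hi => hanti.mono fun t ht => (hpos i hi.le).trans_le ht.1
  rw [← intervalIntegral.sum_integral_adjacent_intervals fun i hi =>
    AntitoneOn.intervalIntegrable (by
      rw [Set.uIcc_of_le (hMmono i hi)]
      exact hanti_Icc i hi), Finset.mul_sum]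
  refine Finset.sum_le_sum fun i hi => ?_
  have hi' := Finset.mem_range.1 hi
  have hM := hpos i hi'.le
  have hη := hη_ge (M i) hM
  have hη' : 0 < η (M i) + 1 := by linarith
  calc ∫ t in (M i)..(M (i + 1)), (φ t + t)⁻¹
      ≤ (M (i + 1) - M i) * (φ (M i) + M i)⁻¹ :=
        (hanti_Icc i hi').intervalIntegral_le_sub_mul (hMmono i hi')
    _ = (M (i + 1) - M i) * ((η (M i) + 1) * M i)⁻¹ := by
        rw [hφ_eq _ hM, add_one_mul]
    _ ≤ ((C - 1) * M i) * ((η (M i) + 1) * M i)⁻¹ := by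
        gcongr
        linarith [hMgrow i hi']
    _ = (C - 1) * (η (M i) + 1)⁻¹ := by
        field_simp
end
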